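/- arXiv:2603.21587 — 2 statements merged into one kernel-verified Lean document; each statement's English description precedes it below -/
import Mathlib

section
/- Let (R,𝔪) be a Cohen-Macaulay local ring with canonical module that is generically Gorenstein and not Gorenstein, let ω be a canonical ideal of R, and let x ∈ ω be an R-regular element. Then X^{ω/x^mR} ≅_ω X^{ω/x^nR} for all m, n ≥ 1, and moreover there exists N ≥ 1 such that X^{ω/x^mR} ≅ X^{ω/x^nR} for all m, n ≥ N. Here X^M denotes the MCM part of the minimal FID hull of M. -/
open CategoryTheory

noncomputable section

/-- The Ext module `Ext^n_R(M, N)` for `R`-modules `M`, `N`. -/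
abbrev ModExt (R : Type) [CommRing R] (n : ℕ) (M N : ModuleCat R) : ModuleCat R :=
  ((Ext R (ModuleCat R) n).obj (Opposite.op M)).obj N

/-- An `R`-module `M` has finite injective dimension if `Ext^i_R(-, M)` vanishes
for all `i` beyond some bound. -/
def HasFiniteInjDim (R : Type) [CommRing R] (M : ModuleCat R) : Prop :=
  ∃ n : ℕ, ∀ (N : ModuleCat R) (i : ℕ), n < i → Subsingleton (ModExt R i N M)

/-- The depth of a module over a local ring, via Rees' characterization:
the least `n` with `Ext^n(k, M) ≠ 0`. -/
def moduleDepth (R : Type) [CommRing R] [IsLocalRing R] (M : ModuleCat R) : ℕ∞ :=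
  sInf {n : ℕ∞ | ∃ m : ℕ, n = (m : ℕ∞) ∧
    Nontrivial (ModExt R m (ModuleCat.of R (IsLocalRing.ResidueField R)) M)}

/-- A Noetherian local ring is Cohen-Macaulay if its depth equals its Krull dimension. -/
def IsCMLocalRing (R : Type) [CommRing R] [IsLocalRing R] : Prop :=
  IsNoetherianRing R ∧
    (moduleDepth R (ModuleCat.of R R) : WithBot ℕ∞) = ringKrullDim R

/-- A maximal Cohen-Macaulay module: finitely generated with depth equal to `dim R`. -/
def IsMCM (R : Type) [CommRing R] [IsLocalRing R] (X : ModuleCat R) : Prop :=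
  Module.Finite R X ∧ (moduleDepth R X : WithBot ℕ∞) = ringKrullDim R

/-- A Cohen-Macaulay module of codimension one:
`depth M = dim M = dim R - 1`. -/
def IsCMofCodimOne (R : Type) [CommRing R] [IsLocalRing R] (M : ModuleCat R) : Prop :=
  Module.Finite R M ∧ ∃ d : ℕ, ringKrullDim R = ((d + 1 : ℕ) : WithBot ℕ∞) ∧
    moduleDepth R M = (d : ℕ∞) ∧
    ringKrullDim (R ⧸ Module.annihilator R M) = ((d : ℕ) : WithBot ℕ∞)

/-- A Gorenstein local ring: Noetherian local with finite injective dimension over itself. -/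
def IsGorensteinLocalRing (A : Type) [CommRing A] : Prop :=
  IsNoetherianRing A ∧ IsLocalRing A ∧ HasFiniteInjDim A (ModuleCat.of A A)

/-- `R` is generically Gorenstein if its localization at every minimal prime is Gorenstein. -/
def IsGenericallyGorenstein (R : Type) [CommRing R] : Prop :=
  ∀ p ∈ minimalPrimes R, ∀ h : p.IsPrime,
    letI := h
    IsGorensteinLocalRing (Localization.AtPrime p)

/-- A canonical module of a local ring `R`: finitely generated, of finite injective
dimension, with `Ext^i(k, ω) ≅ k` for `i = dim R` and `Ext^i(k, ω) = 0` otherwise. -/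
def IsCanonicalModule (R : Type) [CommRing R] [IsLocalRing R] (W : ModuleCat R) : Prop :=
  Module.Finite R W ∧ HasFiniteInjDim R W ∧
    ∃ d : ℕ, ringKrullDim R = (d : ℕ) ∧
      Nonempty ((ModExt R d (ModuleCat.of R (IsLocalRing.ResidueField R)) W) ≃ₗ[R]
        IsLocalRing.ResidueField R) ∧
      ∀ i : ℕ, i ≠ d →
        Subsingleton (ModExt R i (ModuleCat.of R (IsLocalRing.ResidueField R)) W)

/-- A canonical ideal: an ideal of `R` which, as an `R`-module, is a canonical module. -/
def IsCanonicalIdeal (R : Type) [CommRing R] [IsLocalRing R] (I : Ideal R) : Prop :=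
  IsCanonicalModule R (ModuleCat.of R I)

/-- `Y` and `X` have a common nonzero direct summand via the map `ι : Y → X`. -/
def HasCommonSummandVia (R : Type) [CommRing R] {Y X : ModuleCat R}
    (ι : Y →ₗ[R] X) : Prop :=
  ∃ (N Y' X' : ModuleCat.{0} R), Nontrivial N ∧
    ∃ (e : Y ≃ₗ[R] N × Y') (f : X ≃ₗ[R] N × X') (ι' : Y' →ₗ[R] X'),
      ∀ y : Y, f (ι y) = ((e y).1, ι' (e y).2)

/-- `0 → Y → X → M → 0` is an MCM approximation of `M`. -/
def IsMCMApprox (R : Type) [CommRing R] [IsLocalRing R] (M Y X : ModuleCat R)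
    (ι : Y →ₗ[R] X) (π : X →ₗ[R] M) : Prop :=
  Module.Finite R M ∧ Module.Finite R Y ∧ IsMCM R X ∧ HasFiniteInjDim R Y ∧
    Function.Injective ι ∧ Function.Surjective π ∧ Function.Exact ι π

/-- `0 → Y → X → M → 0` is a minimal MCM approximation of `M`. -/
def IsMinMCMApprox (R : Type) [CommRing R] [IsLocalRing R] (M Y X : ModuleCat R)
    (ι : Y →ₗ[R] X) (π : X →ₗ[R] M) : Prop :=
  IsMCMApprox R M Y X ι π ∧ ¬ HasCommonSummandVia R ι

/-- `0 → M → Y → X → 0` is an FID hull of `M`. -/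
def IsFIDHull (R : Type) [CommRing R] [IsLocalRing R] (M Y X : ModuleCat R)
    (ι : M →ₗ[R] Y) (π : Y →ₗ[R] X) : Prop :=
  Module.Finite R M ∧ Module.Finite R Y ∧ HasFiniteInjDim R Y ∧
    (IsMCM R X ∨ Subsingleton X) ∧
    Function.Injective ι ∧ Function.Surjective π ∧ Function.Exact ι π

/-- `0 → M → Y → X → 0` is a minimal FID hull of `M`. -/
def IsMinFIDHull (R : Type) [CommRing R] [IsLocalRing R] (M Y X : ModuleCat R)
    (ι : M →ₗ[R] Y) (π : Y →ₗ[R] X) : Prop :=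
  IsFIDHull R M Y X ι π ∧ ¬ HasCommonSummandVia R π

/-- The free rank of a module: the largest `m` with `R^m` a direct summand. -/
def freeRank (R : Type) [CommRing R] (X : ModuleCat R) : ℕ∞ :=
  sSup {n : ℕ∞ | ∃ m : ℕ, n = (m : ℕ∞) ∧
    ∃ X' : ModuleCat.{0} R, Nonempty (X ≃ₗ[R] ((Fin m → R) × X'))}

/-- The `W`-rank of a module: the largest `m` with `W^m` a direct summand. -/
def wRank (R : Type) [CommRing R] (W X : ModuleCat R) : ℕ∞ :=
  sSup {n : ℕ∞ | ∃ m : ℕ, n = (m : ℕ∞) ∧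
    ∃ X' : ModuleCat.{0} R, Nonempty (X ≃ₗ[R] ((Fin m → W) × X'))}

/-- `M` and `N` are `W`-stably isomorphic. -/
def WStablyIso (R : Type) [CommRing R] (W M N : ModuleCat R) : Prop :=
  ∃ s t : ℕ, Nonempty ((M × (Fin s → W)) ≃ₗ[R] (N × (Fin t → W)))

/-- The quotient module `I/J` (realized as `I` modulo the elements of `J` lying in `I`). -/
abbrev qmod (R : Type) [CommRing R] (I J : Ideal R) : ModuleCat R :=
  ModuleCat.of R (I ⧸ (Submodule.comap I.subtype J))

namespace FIDHull

section Bridge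

variable {R : Type} [CommRing R]

/-- Vanishing of `Ext^n_R(M, N)`, for the `Ext` groups of the abelian category of modules. -/
def ExtVanishes (R : Type) [CommRing R] (n : ℕ) (M N : Type) [AddCommGroup M] [Module R M]
    [AddCommGroup N] [Module R N] : Prop :=
  Subsingleton (Abelian.Ext (ModuleCat.of R M) (ModuleCat.of R N) n)

lemma subsingleton_modExt_succ_iff (M N : ModuleCat.{0} R) (n : ℕ) :
    Subsingleton (ModExt R (n + 1) M N) ↔ Subsingleton (Abelian.Ext M N (n + 1)) := by
  let P := projectiveResolution M
  rw [(P.isoExt (R := R) (n + 1) N).toLinearEquiv.toEquiv.subsingleton_congr,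
    ← ModuleCat.isZero_iff_subsingleton, ← HomologicalComplex.exactAt_iff_isZero_homology,
    HomologicalComplex.exactAt_iff' _ n (n + 1) (n + 2) (by simp) (by simp),
    ShortComplex.moduleCat_exact_iff]
  constructor
  · intro h
    refine subsingleton_of_forall_eq 0 fun e ↦ ?_
    obtain ⟨f, hf, rfl⟩ := P.extMk_surjective e (n + 2) rfl
    rw [P.extMk_eq_zero_iff f (n + 2) rfl hf n rfl]
    obtain ⟨g, hg⟩ := h f hf
    exact ⟨g, hg⟩
  · intro h f hf
    obtain ⟨g, hg⟩ := (P.extMk_eq_zero_iff f (n + 2) rfl hf n rfl).1 (Subsingleton.elim _ _)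
    exact ⟨g, hg⟩

lemma subsingleton_modExt_zero_iff (M N : ModuleCat.{0} R) :
    Subsingleton (ModExt R 0 M N) ↔ Subsingleton (Abelian.Ext M N 0) := by
  let P := projectiveResolution M
  rw [(P.isoExt (R := R) 0 N).toLinearEquiv.toEquiv.subsingleton_congr,
    ← ModuleCat.isZero_iff_subsingleton, ← HomologicalComplex.exactAt_iff_isZero_homology,
    HomologicalComplex.exactAt_iff' _ 0 0 1 (by simp) (by simp),
    ShortComplex.moduleCat_exact_iff, Abelian.Ext.addEquiv₀.toEquiv.subsingleton_congr]
  have hf0 (g : P.complex.X 0 ⟶ N) :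
      (HomologicalComplex.sc' (P.complex.linearYonedaObj R N) 0 0 1).f.hom g = 0 := by
    change P.complex.d 0 0 ≫ g = 0
    simp
  constructor
  · intro h
    refine subsingleton_of_forall_eq 0 fun e ↦ ?_
    obtain ⟨g, hg⟩ := h (P.π.f 0 ≫ (HomologicalComplex.singleObjXSelf _ 0 M).hom ≫ e) (by
      change P.complex.d 1 0 ≫ P.π.f 0 ≫ _ = 0
      rw [P.complex_d_comp_π_f_zero_assoc, Limits.zero_comp])
    have h0 : P.π.f 0 ≫ (HomologicalComplex.singleObjXSelf _ 0 M).hom ≫ e = 0 :=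
      hg.symm.trans (hf0 g)
    rw [← cancel_epi (HomologicalComplex.singleObjXSelf (ComplexShape.down ℕ) 0 M).hom,
      ← cancel_epi (P.π.f 0), h0, Limits.comp_zero, Limits.comp_zero]
  · intro h f hf
    have hl : ∃ l : ((ChainComplex.single₀ (ModuleCat.{0} R)).obj M).X 0 ⟶ N,
        P.π.f 0 ≫ l = f :=
      ⟨_, (Limits.CokernelCofork.IsColimit.desc' P.isColimitCokernelCofork f hf).2⟩
    obtain ⟨l, rfl⟩ := hl
    have hl : l = 0 := by
      rw [← cancel_epi (HomologicalComplex.singleObjXSelf (ComplexShape.down ℕ) 0 M).inv]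
      exact h.elim _ _
    exact ⟨0, by rw [hl, Limits.comp_zero]; exact hf0 0⟩

lemma subsingleton_modExt_iff (M N : ModuleCat.{0} R) (n : ℕ) :
    Subsingleton (ModExt R n M N) ↔ Subsingleton (Abelian.Ext M N n) := by
  cases n with
  | zero => exact subsingleton_modExt_zero_iff M N
  | succ n => exact subsingleton_modExt_succ_iff M N n

end Bridge

section Exact

variable {R : Type} [CommRing R] {A B C N : Type} [AddCommGroup A] [Module R A]
  [AddCommGroup B] [Module R B] [AddCommGroup C] [Module R C] [AddCommGroup N] [Module R N]

/-- The short complex of module objects attached to an exact pair of linear maps. -/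
abbrev sesComplex (f : A →ₗ[R] B) (g : B →ₗ[R] C) (hfg : Function.Exact f g) :
    ShortComplex (ModuleCat.{0} R) :=
  ModuleCat.shortComplexOfCompEqZero f g hfg.linearMap_comp_eq_zero

variable {f : A →ₗ[R] B} {g : B →ₗ[R] C}

lemma sesComplex_shortExact (hf : Function.Injective f) (hfg : Function.Exact f g)
    (hg : Function.Surjective g) : (sesComplex f g hfg).ShortExact :=
  ModuleCat.shortComplex_shortExact _ hfg hf hg

variable (hf : Function.Injective f) (hfg : Function.Exact f g) (hg : Function.Surjective g)
include hf hfg hg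

lemma ExtVanishes.left_mid {n : ℕ} (hA : ExtVanishes R n A N) (hC : ExtVanishes R n C N) :
    ExtVanishes R n B N := by
  have hS := sesComplex_shortExact hf hfg hg
  refine subsingleton_of_forall_eq 0 fun e ↦ ?_
  obtain ⟨e', rfl⟩ := Abelian.Ext.contravariant_sequence_exact₂ hS _ e (hA.elim _ _)
  rw [hC.elim e' 0, Abelian.Ext.comp_zero]

lemma ExtVanishes.left_quot {n : ℕ} (hA : ExtVanishes R n A N) (hB : ExtVanishes R (n + 1) B N) :
    ExtVanishes R (n + 1) C N := by
  have hS := sesComplex_shortExact hf hfg hg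
  refine subsingleton_of_forall_eq 0 fun e ↦ ?_
  obtain ⟨e', rfl⟩ := Abelian.Ext.contravariant_sequence_exact₃ hS _ e (hB.elim _ _) (add_comm 1 n)
  rw [hA.elim e' 0, Abelian.Ext.comp_zero]

lemma ExtVanishes.left_sub {n : ℕ} (hB : ExtVanishes R n B N) (hC : ExtVanishes R (n + 1) C N) :
    ExtVanishes R n A N := by
  have hS := sesComplex_shortExact hf hfg hg
  refine subsingleton_of_forall_eq 0 fun e ↦ ?_
  obtain ⟨e', rfl⟩ := Abelian.Ext.contravariant_sequence_exact₁ hS _ e (add_comm 1 n) (hC.elim _ _)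
  rw [hB.elim e' 0, Abelian.Ext.comp_zero]

lemma ExtVanishes.right_mid {n : ℕ} (hA : ExtVanishes R n N A) (hC : ExtVanishes R n N C) :
    ExtVanishes R n N B := by
  have hS := sesComplex_shortExact hf hfg hg
  refine subsingleton_of_forall_eq 0 fun e ↦ ?_
  obtain ⟨e', rfl⟩ := Abelian.Ext.covariant_sequence_exact₂ _ hS e (hC.elim _ _)
  rw [hA.elim e' 0, Abelian.Ext.zero_comp]

lemma ExtVanishes.right_quot {n : ℕ} (hB : ExtVanishes R n N B) (hA : ExtVanishes R (n + 1) N A) :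
    ExtVanishes R n N C := by
  have hS := sesComplex_shortExact hf hfg hg
  refine subsingleton_of_forall_eq 0 fun e ↦ ?_
  obtain ⟨e', rfl⟩ := Abelian.Ext.covariant_sequence_exact₃ _ hS e rfl (hA.elim _ _)
  rw [hB.elim e' 0, Abelian.Ext.zero_comp]

lemma ExtVanishes.right_sub {n : ℕ} (hC : ExtVanishes R n N C) (hB : ExtVanishes R (n + 1) N B) :
    ExtVanishes R (n + 1) N A := by
  have hS := sesComplex_shortExact hf hfg hg
  refine subsingleton_of_forall_eq 0 fun e ↦ ?_
  obtain ⟨e', rfl⟩ := Abelian.Ext.covariant_sequence_exact₁ _ hS e (hB.elim _ _) rfl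
  rw [hC.elim e' 0, Abelian.Ext.zero_comp]

/-- If `Ext¹(C, N) = 0`, every map `A → N` extends along `A ↪ B` with cokernel `C`. -/
lemma ExtVanishes.exists_extend (h : ExtVanishes R 1 C N) (φ : A →ₗ[R] N) :
    ∃ ψ : B →ₗ[R] N, ψ ∘ₗ f = φ := by
  have hS := sesComplex_shortExact hf hfg hg
  obtain ⟨e, he⟩ := Abelian.Ext.contravariant_sequence_exact₁ hS (ModuleCat.of R N)
    (Abelian.Ext.mk₀ (ModuleCat.ofHom φ)) (n₁ := 1) rfl (h.elim _ _)
  obtain ⟨e, rfl⟩ := Abelian.Ext.mk₀_bijective _ _ |>.2 e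
  rw [Abelian.Ext.mk₀_comp_mk₀] at he
  have := (Abelian.Ext.mk₀_bijective _ _).1 he
  exact ⟨e.hom, congrArg ModuleCat.Hom.hom this⟩

/-- If `Ext¹(N, A) = 0`, every map `N → C` lifts along `B ↠ C` with kernel `A`. -/
lemma ExtVanishes.exists_lift (h : ExtVanishes R 1 N A) (φ : N →ₗ[R] C) :
    ∃ ψ : N →ₗ[R] B, g ∘ₗ ψ = φ := by
  have hS := sesComplex_shortExact hf hfg hg
  obtain ⟨e, he⟩ := Abelian.Ext.covariant_sequence_exact₃ (ModuleCat.of R N) hS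
    (Abelian.Ext.mk₀ (ModuleCat.ofHom φ)) (n₁ := 1) rfl (h.elim _ _)
  obtain ⟨e, rfl⟩ := Abelian.Ext.mk₀_bijective _ _ |>.2 e
  rw [Abelian.Ext.mk₀_comp_mk₀] at he
  have := (Abelian.Ext.mk₀_bijective _ _).1 he
  exact ⟨e.hom, congrArg ModuleCat.Hom.hom this⟩

end Exact

section Basic

variable {R : Type} [CommRing R] {A B C N : Type} [AddCommGroup A] [Module R A]
  [AddCommGroup B] [Module R B] [AddCommGroup C] [Module R C] [AddCommGroup N] [Module R N]

lemma extVanishes_zero_iff : ExtVanishes R 0 A B ↔ Subsingleton (A →ₗ[R] B) :=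
  (Abelian.Ext.addEquiv₀.toEquiv.subsingleton_congr).trans
    (ModuleCat.homAddEquiv.toEquiv.subsingleton_congr)

lemma extVanishes_of_subsingleton_left [Subsingleton A] (n : ℕ) : ExtVanishes R n A B := by
  have h : Limits.IsZero (ModuleCat.of R A) := ModuleCat.isZero_of_subsingleton _
  refine subsingleton_of_forall_eq 0 fun e ↦ ?_
  rw [← Abelian.Ext.mk₀_id_comp e, h.eq_of_src (𝟙 (ModuleCat.of R A)) 0, Abelian.Ext.mk₀_zero,
    Abelian.Ext.zero_comp]

lemma extVanishes_of_subsingleton_right [Subsingleton B] (n : ℕ) : ExtVanishes R n A B := by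
  have h : Limits.IsZero (ModuleCat.of R B) := ModuleCat.isZero_of_subsingleton _
  refine subsingleton_of_forall_eq 0 fun e ↦ ?_
  rw [← Abelian.Ext.comp_mk₀_id e, h.eq_of_src (𝟙 (ModuleCat.of R B)) 0, Abelian.Ext.mk₀_zero,
    Abelian.Ext.comp_zero]

lemma extVanishes_congr_left (e : A ≃ₗ[R] B) {n : ℕ} (h : ExtVanishes R n A N) :
    ExtVanishes R n B N := by
  refine ExtVanishes.left_mid (f := e.toLinearMap) (g := (0 : B →ₗ[R] PUnit)) e.injective
    (fun b ↦ ⟨fun _ ↦ e.surjective b, fun _ ↦ rfl⟩) (fun b ↦ ⟨0, rfl⟩) h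
    (extVanishes_of_subsingleton_left n)

lemma extVanishes_congr_right (e : A ≃ₗ[R] B) {n : ℕ} (h : ExtVanishes R n N A) :
    ExtVanishes R n N B := by
  refine ExtVanishes.right_mid (f := e.toLinearMap) (g := (0 : B →ₗ[R] PUnit)) e.injective
    (fun b ↦ ⟨fun _ ↦ e.surjective b, fun _ ↦ rfl⟩) (fun b ↦ ⟨0, rfl⟩) h
    (extVanishes_of_subsingleton_right n)

lemma ExtVanishes.prod_right {n : ℕ} (hA : ExtVanishes R n N A) (hB : ExtVanishes R n N B) :
    ExtVanishes R n N (A × B) :=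
  ExtVanishes.right_mid (f := LinearMap.inl R A B) (g := LinearMap.snd R A B)
    LinearMap.inl_injective Function.Exact.inl_snd LinearMap.snd_surjective hA hB

lemma extVanishes_succ_of_projective [Module.Projective R A] (n : ℕ) :
    ExtVanishes R (n + 1) A N := by
  have : Projective (ModuleCat.of R A) := inferInstance
  exact Abelian.Ext.subsingleton_of_projective _ _ _

lemma ExtVanishes.pi_right {n : ℕ} (h : ExtVanishes R n N A) :
    ∀ b : ℕ, ExtVanishes R n N (Fin b → A)
  | 0 => extVanishes_of_subsingleton_right n
  | b + 1 => extVanishes_congr_right (Fin.consLinearEquiv R (fun _ : Fin (b + 1) ↦ A))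
      (h.prod_right (ExtVanishes.pi_right h b))

/-- Maps out of a finite free module. -/
def piDualEquiv (R : Type) [CommRing R] (A : Type) [AddCommGroup A] [Module R A] (b : ℕ) :
    (Fin b → A) ≃ₗ[R] ((Fin b → R) →ₗ[R] A) :=
  (Pi.basisFun R (Fin b)).constr R

lemma ExtVanishes.dual_right {n : ℕ} (h : ExtVanishes R n N A) (b : ℕ) :
    ExtVanishes R n N ((Fin b → R) →ₗ[R] A) :=
  extVanishes_congr_right (piDualEquiv R A b) (h.pi_right b)

end Basic

open scoped Pointwise


section Regular

variable {R : Type} [CommRing R] {N W : Type} [AddCommGroup N] [Module R N]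
  [AddCommGroup W] [Module R W] {z : R}

lemma smulId_exact (z : R) (W : Type) [AddCommGroup W] [Module R W] :
    Function.Exact (z • (LinearMap.id : W →ₗ[R] W)) (Submodule.mkQ (z • ⊤ : Submodule R W)) := by
  intro w
  rw [Submodule.mkQ_apply, Submodule.Quotient.mk_eq_zero, Submodule.mem_smul_pointwise_iff_exists]
  simp

lemma smul_eq_mk₀_comp {n : ℕ} (e : Abelian.Ext (ModuleCat.of R N) (ModuleCat.of R W) n) :
    (Abelian.Ext.mk₀ (ModuleCat.ofHom (z • (LinearMap.id : N →ₗ[R] N)))).comp e (zero_add n) =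
      z • e := by
  have : ModuleCat.ofHom (z • (LinearMap.id : N →ₗ[R] N)) = z • 𝟙 (ModuleCat.of R N) := rfl
  rw [this, Abelian.Ext.mk₀_smul, Abelian.Ext.smul_comp, Abelian.Ext.mk₀_id_comp]

lemma comp_mk₀_eq_smul {n : ℕ} (e : Abelian.Ext (ModuleCat.of R N) (ModuleCat.of R W) n) :
    e.comp (Abelian.Ext.mk₀ (ModuleCat.ofHom (z • (LinearMap.id : W →ₗ[R] W)))) (add_zero n) =
      z • e := by
  have : ModuleCat.ofHom (z • (LinearMap.id : W →ₗ[R] W)) = z • 𝟙 (ModuleCat.of R W) := rfl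
  rw [this, Abelian.Ext.mk₀_smul, Abelian.Ext.comp_smul, Abelian.Ext.comp_mk₀_id]

lemma smul_ext_eq_zero_of_left {n : ℕ} (hz : ∀ a : N, z • a = 0)
    (e : Abelian.Ext (ModuleCat.of R N) (ModuleCat.of R W) n) : z • e = 0 := by
  have : z • (LinearMap.id : N →ₗ[R] N) = 0 := by ext a; exact hz a
  rw [← smul_eq_mk₀_comp, this, ModuleCat.ofHom_zero, Abelian.Ext.mk₀_zero, Abelian.Ext.zero_comp]

/-- Nakayama's lemma for `Ext` along a regular element of the first variable. -/
lemma ExtVanishes.of_quotSMulTop_left [IsLocalRing R] [IsNoetherianRing R] [Module.Finite R N]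
    [Module.Finite R W] (hz : z ∈ IsLocalRing.maximalIdeal R) (hr : IsSMulRegular N z) {n : ℕ}
    (h : ExtVanishes R (n + 1) (QuotSMulTop z N) W) : ExtVanishes R n N W := by
  have hS := sesComplex_shortExact (f := z • (LinearMap.id : N →ₗ[R] N)) hr (smulId_exact z N)
    (Submodule.mkQ_surjective _)
  have key : (⊤ : Submodule R (Abelian.Ext (ModuleCat.of R N) (ModuleCat.of R W) n)) ≤
      IsLocalRing.maximalIdeal R • ⊤ := by
    rintro e -
    obtain ⟨e', rfl⟩ := Abelian.Ext.contravariant_sequence_exact₁ hS _ e (add_comm 1 n)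
      (h.elim _ _)
    rw [smul_eq_mk₀_comp]
    exact Submodule.smul_mem_smul hz trivial
  have := Submodule.eq_bot_of_le_smul_of_le_jacobson_bot _ _ (Module.Finite.fg_top) key
    (IsLocalRing.maximalIdeal_le_jacobson _)
  exact (Submodule.subsingleton_iff R).1 (subsingleton_of_bot_eq_top this.symm)

lemma ExtVanishes.of_quotSMulTop_right (hz : ∀ a : N, z • a = 0) (hr : IsSMulRegular W z) {n : ℕ}
    (h : ExtVanishes R n N (QuotSMulTop z W)) : ExtVanishes R (n + 1) N W := by
  have hS := sesComplex_shortExact (f := z • (LinearMap.id : W →ₗ[R] W)) hr (smulId_exact z W)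
    (Submodule.mkQ_surjective _)
  refine subsingleton_of_forall_eq 0 fun e ↦ ?_
  obtain ⟨e', rfl⟩ := Abelian.Ext.covariant_sequence_exact₁ _ hS e
    ((comp_mk₀_eq_smul e).trans (smul_ext_eq_zero_of_left hz e)) rfl
  rw [h.elim e' 0, Abelian.Ext.zero_comp]

lemma ExtVanishes.quotSMulTop_right (hr : IsSMulRegular W z) {n : ℕ}
    (h : ExtVanishes R n N W) (h' : ExtVanishes R (n + 1) N W) :
    ExtVanishes R n N (QuotSMulTop z W) :=
  ExtVanishes.right_quot (f := z • (LinearMap.id : W →ₗ[R] W)) hr (smulId_exact z W)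
    (Submodule.mkQ_surjective _) h h'

lemma ExtVanishes.quotSMulTop_left (hr : IsSMulRegular N z) {n : ℕ}
    (h : ExtVanishes R n N W) (h' : ExtVanishes R (n + 1) N W) :
    ExtVanishes R (n + 1) (QuotSMulTop z N) W :=
  ExtVanishes.left_quot (f := z • (LinearMap.id : N →ₗ[R] N)) hr (smulId_exact z N)
    (Submodule.mkQ_surjective _) h h'

end Regular

section InjDim

open RingTheory.Sequence IsLocalRing

variable {R : Type} [CommRing R] [IsLocalRing R] {Y : Type} [AddCommGroup Y] [Module R Y]

lemma smul_residueField_eq_zero {z : R} (hz : z ∈ maximalIdeal R) (a : ResidueField R) :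
    z • a = 0 := by
  rw [Algebra.smul_def, ResidueField.algebraMap_eq, (residue_eq_zero_iff z).2 hz, zero_mul]

lemma exists_residueField_embedding_of_isWeaklyRegular (rs : List R) : ∀ (W : Type)
    [AddCommGroup W] [Module R W] [Module.Finite R W] (a : ℕ), IsWeaklyRegular W rs →
    (∀ r ∈ rs, r ∈ maximalIdeal R) → (∀ i, a < i → ExtVanishes R i W Y) →
    ¬ ExtVanishes R rs.length (ResidueField R) W →
    ∃ K : ModuleCat.{0} R, Module.Finite R K ∧ ¬ ExtVanishes R 0 (ResidueField R) K ∧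
      ∀ i, a + rs.length < i → ExtVanishes R i K Y := by
  induction rs with
  | nil => exact fun W _ _ _ a _ _ hW hk ↦ ⟨ModuleCat.of R W, ‹_›, hk, hW⟩
  | cons z rs ih =>
    intro W _ _ _ a hreg hm hW hk
    rw [isWeaklyRegular_cons_iff] at hreg
    obtain ⟨K, hK, hk', hKY⟩ := ih (QuotSMulTop z W) (a + 1) hreg.2
      (fun r hr ↦ hm r (List.mem_cons_of_mem _ hr))
      (fun i hi ↦ by
        obtain ⟨i, rfl⟩ : ∃ j, i = j + 1 := ⟨i - 1, by omega⟩
        exact (hW i (by omega)).quotSMulTop_left hreg.1 (hW _ (by omega)))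
      (fun h ↦ hk (h.of_quotSMulTop_right
        (smul_residueField_eq_zero (hm z List.mem_cons_self)) hreg.1))
    exact ⟨K, hK, hk', fun i hi ↦ hKY i (by simp only [List.length_cons] at hi; omega)⟩

lemma injective_of_residueField {K : Type} [AddCommGroup K] [Module R K]
    {f : ResidueField R →ₗ[R] K} (hf : f ≠ 0) : Function.Injective f := by
  have : IsSimpleModule R (ResidueField R) := by
    change IsSimpleModule R (R ⧸ maximalIdeal R)
    exact isSimpleModule_iff_isCoatom.2 (maximalIdeal.isMaximal R).out
  exact LinearMap.injective_of_ne_zero hf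

/-- A finitely generated module over a local ring is `0` or has a regular sequence of length `d`
as soon as `Ext^i(k, X) = 0` for `i < d`. -/
lemma exists_isWeaklyRegular [IsNoetherianRing R] (X : Type) [AddCommGroup X] [Module R X]
    [Module.Finite R X] [Nontrivial X] (d : ℕ)
    (h : ∀ i < d, ExtVanishes R i (ResidueField R) X) :
    ∃ rs : List R, rs.length = d ∧ (∀ r ∈ rs, r ∈ maximalIdeal R) ∧ IsWeaklyRegular X rs := by
  obtain ⟨rs, h1, h2, h3⟩ := ModuleCat.exists_isRegular_of_exists_subsingleton_ext
    (maximalIdeal R) d (ModuleCat.of R X) (by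
      rw [lt_top_iff_ne_top]
      intro htop
      have := Submodule.eq_bot_of_le_smul_of_le_jacobson_bot (maximalIdeal R)
        (⊤ : Submodule R X) (Module.Finite.fg_top) htop.ge (IsLocalRing.maximalIdeal_le_jacobson _)
      exact top_ne_bot this) (ModuleCat.of R (ResidueField R)) (by
      change Module.support R (R ⧸ maximalIdeal R) = _
      rw [Module.support_eq_zeroLocus, Ideal.annihilator_quotient]) h
  exact ⟨rs, h1, h2, h3.toIsWeaklyRegular⟩

end InjDim

section InjDim

open RingTheory.Sequence IsLocalRing

variable {R : Type} [CommRing R] [IsLocalRing R] [IsNoetherianRing R]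
  {Y : Type} [AddCommGroup Y] [Module R Y] [Module.Finite R Y] {d : ℕ}

variable (hR : ∀ i < d, ExtVanishes R i (ResidueField R) R)
  (hRd : ¬ ExtVanishes R d (ResidueField R) R)
include hR hRd

omit [Module.Finite R Y] in
lemma extVanishes_residueField_of_succ {r : ℕ} (hr : d < r)
    (h : ∀ (N : Type) [AddCommGroup N] [Module R N] [Module.Finite R N],
      ExtVanishes R (r + 1) N Y) : ExtVanishes R r (ResidueField R) Y := by
  obtain ⟨rs, hlen, hm, hreg⟩ := exists_isWeaklyRegular R d hR
  obtain ⟨K, _, hK, hKY⟩ := exists_residueField_embedding_of_isWeaklyRegular (Y := Y) rs R 0 hreg hm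
    (fun i hi ↦ by
      obtain ⟨i, rfl⟩ : ∃ j, i = j + 1 := ⟨i - 1, by omega⟩
      exact extVanishes_succ_of_projective i) (hlen ▸ hRd)
  rw [extVanishes_zero_iff, not_subsingleton_iff_nontrivial] at hK
  obtain ⟨f, hf⟩ := exists_ne (0 : ResidueField R →ₗ[R] K)
  exact ExtVanishes.left_sub (injective_of_residueField hf) (LinearMap.exact_map_mkQ_range f)
    (Submodule.mkQ_surjective _) (hKY r (by omega)) (h _)

lemma extVanishes_of_succ {r : ℕ} (hr : d < r)
    (h : ∀ (N : Type) [AddCommGroup N] [Module R N] [Module.Finite R N],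
      ExtVanishes R (r + 1) N Y) (N : Type) [AddCommGroup N] [Module R N] [Module.Finite R N] :
    ExtVanishes R r N Y := by
  refine IsNoetherianRing.induction_on_isQuotientEquivQuotientPrime R (M := N) inferInstance
    (motive := fun N _ _ _ ↦ ExtVanishes R r N Y) ?_ ?_ ?_
  · intro N _ _ _ _
    exact extVanishes_of_subsingleton_left r
  · intro N _ _ _ p e
    refine extVanishes_congr_left e.symm ?_
    by_cases hp : p.1 = maximalIdeal R
    · rw [hp]
      exact extVanishes_residueField_of_succ hR hRd hr h
    · obtain ⟨z, hz, hzp⟩ := SetLike.exists_of_lt (lt_of_le_of_ne (le_maximalIdeal p.2.ne_top) hp)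
      refine ExtVanishes.of_quotSMulTop_left hz ?_ (h _)
      intro a b hab
      have : p.1.IsPrime := p.2
      have hz0 : (Ideal.Quotient.mk p.1 z) ≠ 0 := by rwa [Ne, Ideal.Quotient.eq_zero_iff_mem]
      refine mul_left_cancel₀ hz0 ?_
      simpa [Algebra.smul_def] using hab
  · intro N₁ _ _ _ N₂ _ _ _ N₃ _ _ _ f g hf hg hfg h₁ h₃
    exact ExtVanishes.left_mid hf hfg hg h₁ h₃

/-- The injective dimension of a finitely generated module of finite injective dimension is at most
the depth of the ring. -/
lemma extVanishes_of_depth_lt (hY : ∃ n : ℕ, ∀ (N : Type) [AddCommGroup N] [Module R N]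
      (i : ℕ), n < i → ExtVanishes R i N Y) {r : ℕ} (hr : d < r)
    (N : Type) [AddCommGroup N] [Module R N] [Module.Finite R N] : ExtVanishes R r N Y := by
  obtain ⟨n, hn⟩ := hY
  have key : ∀ j r, d < r → n < r + j → ∀ (N : Type) [AddCommGroup N] [Module R N]
      [Module.Finite R N], ExtVanishes R r N Y := by
    intro j
    induction j with
    | zero => exact fun r _ h N _ _ _ ↦ hn N r h
    | succ j ih =>
      intro r hr hj
      exact extVanishes_of_succ hR hRd hr (ih (r + 1) (by omega) (by omega))
  exact key (n + 1) r hr (by omega) N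

lemma extVanishes_of_isWeaklyRegular (hY : ∃ n : ℕ, ∀ (N : Type) [AddCommGroup N] [Module R N]
      (i : ℕ), n < i → ExtVanishes R i N Y) (rs : List R) :
    ∀ (W : Type) [AddCommGroup W] [Module R W] [Module.Finite R W], IsWeaklyRegular W rs →
      (∀ r ∈ rs, r ∈ maximalIdeal R) → ∀ i, d < i + rs.length → ExtVanishes R i W Y := by
  induction rs with
  | nil => exact fun W _ _ _ _ _ i hi ↦ extVanishes_of_depth_lt hR hRd hY hi W
  | cons z rs ih =>
    intro W _ _ _ hreg hm i hi
    rw [isWeaklyRegular_cons_iff] at hreg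
    refine ExtVanishes.of_quotSMulTop_left (hm z List.mem_cons_self) hreg.1
      (ih (QuotSMulTop z W) hreg.2 (fun r hr ↦ hm r (List.mem_cons_of_mem _ hr)) (i + 1) ?_)
    simp only [List.length_cons] at hi
    omega

/-- Maximal Cohen-Macaulay modules have no higher extensions by modules of finite injective
dimension. -/
lemma extVanishes_of_mcm (hY : ∃ n : ℕ, ∀ (N : Type) [AddCommGroup N] [Module R N]
      (i : ℕ), n < i → ExtVanishes R i N Y) (X : Type) [AddCommGroup X] [Module R X]
    [Module.Finite R X] (hX : ∀ i < d, ExtVanishes R i (ResidueField R) X) {i : ℕ} (hi : 0 < i) :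
    ExtVanishes R i X Y := by
  rcases subsingleton_or_nontrivial X with h | h
  · exact extVanishes_of_subsingleton_left i
  · obtain ⟨rs, hlen, hm, hreg⟩ := exists_isWeaklyRegular X d hX
    exact extVanishes_of_isWeaklyRegular hR hRd hY rs X hreg hm i (by omega)

end InjDim


section ExtSurj

variable {R : Type} [CommRing R]

/-- `Ext^i(-, W)` turns inclusions of finitely generated modules killed by `I` into surjections. -/
def ExtSurj (I : Ideal R) (i : ℕ) (W : Type) [AddCommGroup W] [Module R W] : Prop :=
  ∀ (N' N : Type) [AddCommGroup N'] [Module R N'] [Module.Finite R N'] [AddCommGroup N]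
    [Module R N] [Module.Finite R N] (f : N' →ₗ[R] N), Function.Injective f →
    (∀ a ∈ I, ∀ n : N, a • n = 0) →
    ∀ e : Abelian.Ext (ModuleCat.of R N') (ModuleCat.of R W) i,
      ∃ e' : Abelian.Ext (ModuleCat.of R N) (ModuleCat.of R W) i,
        (Abelian.Ext.mk₀ (ModuleCat.ofHom f)).comp e' (zero_add i) = e

variable {I : Ideal R} {i : ℕ} {W : Type} [AddCommGroup W] [Module R W]

lemma extSurj_of_extVanishes (h : ∀ (N : Type) [AddCommGroup N] [Module R N] [Module.Finite R N],
    ExtVanishes R (i + 1) N W) : ExtSurj I i W := by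
  intro N' N _ _ _ _ _ _ f hf _ e
  exact Abelian.Ext.contravariant_sequence_exact₁
    (sesComplex_shortExact hf (LinearMap.exact_map_mkQ_range f) (Submodule.mkQ_surjective _)) _ e
    (add_comm 1 i) ((h _).elim _ _)

lemma ExtSurj.quotSMulTop {z : R} (hzI : z ∈ I) (hz : IsSMulRegular W z)
    (hV : ∀ (N : Type) [AddCommGroup N] [Module R N] [Module.Finite R N],
      (∀ a ∈ I, ∀ n : N, a • n = 0) → ExtVanishes R i N W)
    (h : ExtSurj I (i + 1) W) : ExtSurj I i (QuotSMulTop z W) := by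
  intro N' N _ _ _ _ _ _ f hf hN e
  have hN' : ∀ a ∈ I, ∀ n : N', a • n = 0 := fun a ha n ↦ hf (by rw [map_smul, hN a ha, map_zero])
  have hS := sesComplex_shortExact (f := z • (LinearMap.id : W →ₗ[R] W)) hz (smulId_exact z W)
    (Submodule.mkQ_surjective _)
  obtain ⟨e', he'⟩ := h N' N f hf hN (e.comp hS.extClass rfl)
  obtain ⟨e'', rfl⟩ := Abelian.Ext.covariant_sequence_exact₁ _ hS e'
    ((comp_mk₀_eq_smul e').trans (smul_ext_eq_zero_of_left (hN z hzI) e')) rfl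
  refine ⟨e'', ?_⟩
  rw [← sub_eq_zero]
  obtain ⟨t, ht⟩ := Abelian.Ext.covariant_sequence_exact₃ _ hS
    ((Abelian.Ext.mk₀ (ModuleCat.ofHom f)).comp e'' (zero_add i) - e) rfl (by
      rw [sub_eq_add_neg, Abelian.Ext.add_comp, Abelian.Ext.neg_comp, ← sub_eq_add_neg, sub_eq_zero,
        ← he']
      exact Abelian.Ext.comp_assoc _ _ _ (zero_add i) rfl (by omega))
  rw [← ht, (hV N' hN').elim t 0, Abelian.Ext.zero_comp]

lemma ExtSurj.exists_extend (h : ExtSurj I 0 W) {N' N : Type} [AddCommGroup N'] [Module R N']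
    [Module.Finite R N'] [AddCommGroup N] [Module R N] [Module.Finite R N] (f : N' →ₗ[R] N)
    (hf : Function.Injective f) (hN : ∀ a ∈ I, ∀ n : N, a • n = 0) (ψ : N' →ₗ[R] W) :
    ∃ φ : N →ₗ[R] W, φ ∘ₗ f = ψ := by
  obtain ⟨e, he⟩ := h N' N f hf hN (Abelian.Ext.mk₀ (ModuleCat.ofHom ψ))
  obtain ⟨e, rfl⟩ := Abelian.Ext.mk₀_bijective _ _ |>.2 e
  rw [Abelian.Ext.mk₀_comp_mk₀] at he
  exact ⟨e.hom, congrArg ModuleCat.Hom.hom ((Abelian.Ext.mk₀_bijective _ _).1 he)⟩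

lemma extVanishes_of_isWeaklyRegular_right (rs : List R) : ∀ (W : Type) [AddCommGroup W]
    [Module R W], RingTheory.Sequence.IsWeaklyRegular W rs → ∀ (N : Type) [AddCommGroup N]
    [Module R N], (∀ r ∈ rs, ∀ n : N, r • n = 0) → ∀ i < rs.length, ExtVanishes R i N W := by
  induction rs with
  | nil => exact fun W _ _ _ N _ _ _ i hi ↦ absurd hi (Nat.not_lt_zero i)
  | cons z rs ih =>
    intro W _ _ hreg N _ _ hN i hi
    rw [RingTheory.Sequence.isWeaklyRegular_cons_iff] at hreg
    cases i with
    | zero =>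
      rw [extVanishes_zero_iff]
      refine subsingleton_of_forall_eq 0 fun f ↦ LinearMap.ext fun n ↦ hreg.1 ?_
      simp only [LinearMap.zero_apply, smul_zero]
      rw [← map_smul, hN z List.mem_cons_self, map_zero]
    | succ i =>
      exact (ih (QuotSMulTop z W) hreg.2 N (fun r hr ↦ hN r (List.mem_cons_of_mem _ hr)) i
        (Nat.lt_of_succ_lt_succ hi)).of_quotSMulTop_right (hN z List.mem_cons_self) hreg.1

lemma exists_eq_smul_of_mkQ_comp_eq_zero {A : Type} [AddCommGroup A] [Module R A] {z : R} (hz : IsSMulRegular W z) {φ : A →ₗ[R] W}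
    (h : ∀ a, φ a ∈ (z • ⊤ : Submodule R W)) : ∃ g : A →ₗ[R] W, φ = z • g := by
  let e := LinearEquiv.ofInjective (z • (LinearMap.id : W →ₗ[R] W)) hz
  have h' : ∀ a, φ a ∈ LinearMap.range (z • (LinearMap.id : W →ₗ[R] W)) := fun a ↦
    (smulId_exact z W (φ a)).1 (by rw [Submodule.mkQ_apply, Submodule.Quotient.mk_eq_zero]; exact h a)
  refine ⟨e.symm.toLinearMap ∘ₗ φ.codRestrict _ h', ?_⟩
  ext a
  have := congrArg Subtype.val (e.apply_symm_apply (φ.codRestrict _ h' a))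
  exact this.symm

end ExtSurj

section EndRing

open RingTheory.Sequence IsLocalRing

variable {R : Type} [CommRing R] [IsLocalRing R] [IsNoetherianRing R]

variable {E : Type} [AddCommGroup E] [Module R E] [Module.Finite R E]
  (hcomm : ∀ (f g : E →ₗ[R] E) (a : E), f (g a) = g (f a))
include hcomm

omit [IsNoetherianRing R] in
lemma exists_eq_smul_of_extSurj_zero {I : Ideal R} {W : Type} [AddCommGroup W] [Module R W]
    [Module.Finite R W] (p : E →ₗ[R] W)
    (hlift : ∀ f : E →ₗ[R] W, ∃ f' : E →ₗ[R] E, p ∘ₗ f' = f) (hI : ∀ a ∈ I, ∀ w : W, a • w = 0)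
    (hs : ExtSurj I 0 W) (hk : ¬ ExtVanishes R 0 (ResidueField R) W)
    (hker : ∀ (h : E →ₗ[R] E) (a : E), p a = 0 → p (h a) = 0) (f : E →ₗ[R] W) :
    ∃ r : R, f = r • p := by
  obtain ⟨n, g, hg⟩ := Module.Finite.exists_fin (R := R) (M := E)
  by_cases hv : (f ∘ g) ∈ Submodule.span R {p ∘ g}
  · obtain ⟨r, hr⟩ := Submodule.mem_span_singleton.1 hv
    refine ⟨r, LinearMap.ext_on_range hg fun i ↦ ?_⟩
    exact (congrFun hr i).symm
  exfalso
  let S := Submodule.span R {p ∘ g}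
  let v : (Fin n → W) ⧸ S := S.mkQ (f ∘ g)
  have hv0 : v ≠ 0 := fun h ↦ hv ((Submodule.Quotient.mk_eq_zero S).1 h)
  let τ := LinearMap.toSpanSingleton R _ v
  have hτ : LinearMap.ker τ ≤ maximalIdeal R := by
    refine le_maximalIdeal fun h ↦ hv0 ?_
    have : (1 : R) ∈ LinearMap.ker τ := h ▸ trivial
    simpa [τ] using this
  rw [extVanishes_zero_iff, not_subsingleton_iff_nontrivial] at hk
  obtain ⟨κ, hκ⟩ := exists_ne (0 : ResidueField R →ₗ[R] W)
  have hκ1 : κ 1 ≠ 0 := fun h ↦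
    one_ne_zero (injective_of_residueField hκ (h.trans (map_zero κ).symm))
  let ψ : (R ⧸ LinearMap.ker τ) →ₗ[R] W :=
    (κ : (R ⧸ maximalIdeal R) →ₗ[R] W) ∘ₗ Submodule.factor hτ
  obtain ⟨φ, hφ⟩ := hs.exists_extend ((LinearMap.ker τ).liftQ τ le_rfl)
    (LinearMap.ker_eq_bot.1 (Submodule.ker_liftQ_eq_bot _ _ _ le_rfl)) (fun a ha w ↦ by
      obtain ⟨w, rfl⟩ := S.mkQ_surjective w
      rw [← map_smul]
      have : a • w = 0 := funext fun i ↦ hI a ha (w i)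
      rw [this, map_zero]) ψ
  have hφv : φ v = κ 1 := by
    have := LinearMap.congr_fun hφ (Submodule.Quotient.mk 1)
    simp only [LinearMap.comp_apply, Submodule.liftQ_apply] at this
    have h1 : φ v = ψ 1 := by simpa [τ] using this
    exact h1
  have hφsum (u : Fin n → W) : φ (S.mkQ u) = ∑ i, (φ ∘ₗ S.mkQ ∘ₗ LinearMap.single R _ i) (u i) := by
    conv_lhs => rw [← Finset.univ_sum_single u, map_sum, map_sum]
    rfl
  choose g' hg' using fun i ↦ hlift ((φ ∘ₗ S.mkQ ∘ₗ LinearMap.single R _ i) ∘ₗ p)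
  obtain ⟨f', rfl⟩ := hlift f
  have h1 : p (∑ i, g' i (g i)) = 0 := by
    have h2 : S.mkQ (p ∘ g) = 0 :=
      (Submodule.Quotient.mk_eq_zero S).2 (Submodule.mem_span_singleton_self _)
    have h3 := hφsum (p ∘ g)
    rw [h2, map_zero] at h3
    rw [map_sum, h3]
    exact Finset.sum_congr rfl fun i _ ↦ LinearMap.congr_fun (hg' i) (g i)
  refine hκ1 ?_
  rw [← hφv, ← hker f' _ h1, map_sum, map_sum, hφsum]
  refine Finset.sum_congr rfl fun i _ ↦ ?_
  rw [hcomm f' (g' i)]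
  exact (LinearMap.congr_fun (hg' i) (f' (g i))).symm

lemma exists_eq_smul_of_isWeaklyRegular {I : Ideal R} (rs : List R) :
    ∀ (W : Type) [AddCommGroup W] [Module R W] [Module.Finite R W] (p : E →ₗ[R] W),
    Function.Surjective p →
    (∀ f : E →ₗ[R] W, ∃ f' : E →ₗ[R] E, p ∘ₗ f' = f) →
    (∀ i, ExtVanishes R (i + 1) E W) → ExtSurj I rs.length W → IsWeaklyRegular W rs →
    (∀ r ∈ rs, r ∈ maximalIdeal R) → (∀ r ∈ rs, r ∈ I) →
    (∀ a ∈ I, ∃ b ∈ Ideal.ofList rs, ∀ w : W, a • w = b • w) →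
    ¬ ExtVanishes R rs.length (ResidueField R) W →
    (∀ (h : E →ₗ[R] E) (a : E), p a = 0 → p (h a) = 0) →
    ∀ f : E →ₗ[R] W, ∃ r : R, f = r • p := by
  induction rs with
  | nil =>
    intro W _ _ _ p _ hlift _ hs _ _ _ hI hk hker f
    refine exists_eq_smul_of_extSurj_zero hcomm p hlift (fun a ha w ↦ ?_) hs hk hker f
    obtain ⟨b, hb, h⟩ := hI a ha
    rw [Ideal.ofList_nil, Ideal.mem_bot] at hb
    rw [h, hb, zero_smul]
  | cons z rs ih =>
    intro W _ _ _ p hp hlift hE hs hreg hm hrsI hI hk hker f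
    have hrsI' := fun N [AddCommGroup N] [Module R N] (hN : ∀ a ∈ I, ∀ n : N, a • n = 0) ↦
      extVanishes_of_isWeaklyRegular_right (z :: rs) W hreg N (fun r hr ↦ hN r (hrsI r hr)) rs.length
        (by simp)
    rw [isWeaklyRegular_cons_iff] at hreg
    have hz := hm z List.mem_cons_self
    let π : W →ₗ[R] QuotSMulTop z W := Submodule.mkQ _
    have hπ : Function.Surjective π := Submodule.mkQ_surjective _
    have key : ∀ f : E →ₗ[R] QuotSMulTop z W, ∃ r : R, f = r • (π ∘ₗ p) := by
      refine ih (QuotSMulTop z W) (π ∘ₗ p) (hπ.comp hp) ?_ ?_ ?_ hreg.2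
        (fun r hr ↦ hm r (List.mem_cons_of_mem _ hr)) (fun r hr ↦ hrsI r (List.mem_cons_of_mem _ hr))
        ?_ ?_ ?_
      · intro f
        obtain ⟨f₁, rfl⟩ := (hE 0).exists_lift (f := z • (LinearMap.id : W →ₗ[R] W)) hreg.1
          (smulId_exact z W) hπ f
        obtain ⟨f₂, rfl⟩ := hlift f₁
        exact ⟨f₂, rfl⟩
      · exact fun i ↦ (hE i).quotSMulTop_right hreg.1 (hE (i + 1))
      · exact hs.quotSMulTop (hrsI z List.mem_cons_self) hreg.1 fun N _ _ _ hN ↦ hrsI' N hN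
      · intro a ha
        obtain ⟨b, hb, hab⟩ := hI a ha
        rw [Ideal.ofList_cons, Submodule.mem_sup] at hb
        obtain ⟨c, hc, b, hb, rfl⟩ := hb
        obtain ⟨c, rfl⟩ := Ideal.mem_span_singleton'.1 hc
        refine ⟨b, hb, fun w ↦ ?_⟩
        obtain ⟨w, rfl⟩ := hπ w
        rw [← map_smul, hab, add_smul, map_add, map_smul, map_smul, add_eq_right, mul_comm, mul_smul,
          ← map_smul, ← map_smul]
        exact (Submodule.Quotient.mk_eq_zero _).2
          (Submodule.smul_mem_pointwise_smul _ _ _ trivial)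
      · exact fun h ↦ hk (h.of_quotSMulTop_right (smul_residueField_eq_zero hz) hreg.1)
      · intro h a ha
        obtain ⟨w, -, hw⟩ := (Submodule.mem_smul_pointwise_iff_exists _ _ _).1
          ((Submodule.Quotient.mk_eq_zero _).1 ha)
        obtain ⟨b, rfl⟩ := hp w
        have h1 := hker h (a - z • b) (by rw [map_sub, map_smul, hw, sub_self])
        rw [map_sub, map_smul, map_sub, map_smul, sub_eq_zero] at h1
        refine (Submodule.Quotient.mk_eq_zero _).2 ?_
        rw [h1]
        exact Submodule.smul_mem_pointwise_smul _ _ _ trivial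
    have hle : (⊤ : Submodule R (E →ₗ[R] W)) ≤ Submodule.span R {p} ⊔ maximalIdeal R • ⊤ := by
      rintro f -
      obtain ⟨r, hr⟩ := key (π ∘ₗ f)
      obtain ⟨g, hg⟩ := exists_eq_smul_of_mkQ_comp_eq_zero hreg.1 (φ := f - r • p) (fun a ↦ by
        refine (Submodule.Quotient.mk_eq_zero _).1 ?_
        have := LinearMap.congr_fun hr a
        change π (f a - r • p a) = 0
        rw [map_sub, sub_eq_zero, map_smul]
        exact this)
      rw [← sub_add_cancel f (r • p), hg, add_comm]
      exact Submodule.add_mem_sup (Submodule.smul_mem _ _ (Submodule.mem_span_singleton_self p))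
        (Submodule.smul_mem_smul hz trivial)
    have := Submodule.le_of_le_smul_of_le_jacobson_bot Module.Finite.fg_top
      (maximalIdeal_le_jacobson _) hle
    obtain ⟨r, hr⟩ := Submodule.mem_span_singleton.1 (this (Submodule.mem_top (x := f)))
    exact ⟨r, hr.symm⟩

/-- A canonical module with commutative endomorphism ring has only homotheties as endomorphisms. -/
lemma exists_eq_smul_id {d : ℕ} (hR : ∀ i < d, ExtVanishes R i (ResidueField R) R)
    (hRd : ¬ ExtVanishes R d (ResidueField R) R)
    (hE : ∃ n : ℕ, ∀ (N : Type) [AddCommGroup N] [Module R N] (i : ℕ), n < i → ExtVanishes R i N E)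
    (hEk : ∀ i < d, ExtVanishes R i (ResidueField R) E)
    (hEd : ¬ ExtVanishes R d (ResidueField R) E) (f : E →ₗ[R] E) :
    ∃ r : R, f = r • LinearMap.id := by
  have : Nontrivial E := by
    rw [← not_subsingleton_iff_nontrivial]
    exact fun h ↦ hEd (extVanishes_of_subsingleton_right d)
  obtain ⟨rs, rfl, hm, hreg⟩ := exists_isWeaklyRegular E d hEk
  exact exists_eq_smul_of_isWeaklyRegular hcomm (I := Ideal.ofList rs) rs E LinearMap.id
    Function.surjective_id (fun f ↦ ⟨f, rfl⟩)
    (fun i ↦ extVanishes_of_mcm hR hRd hE E hEk i.succ_pos)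
    (extSurj_of_extVanishes fun N _ _ _ ↦ extVanishes_of_depth_lt hR hRd hE (Nat.lt_succ_self _) N)
    hreg hm (fun r hr ↦ Ideal.subset_span hr) (fun a ha ↦ ⟨a, ha, fun _ ↦ rfl⟩) hEd
    (fun h a ha ↦ by rw [LinearMap.id_apply] at ha; rw [ha, map_zero, map_zero]) f

end EndRing

section Dual

open IsLocalRing

variable {R : Type} [CommRing R] [IsLocalRing R] [IsNoetherianRing R]

omit [IsNoetherianRing R] in
lemma exists_minimal_generators (M : Type) [AddCommGroup M] [Module R M] [Module.Finite R M] :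
    ∃ (b : ℕ) (g : (Fin b → R) →ₗ[R] M), Function.Surjective g ∧
      ∀ l, g l = 0 → ∀ i, l i ∈ maximalIdeal R := by
  have hex : ∃ (b : ℕ) (g : (Fin b → R) →ₗ[R] M), Function.Surjective g := Module.Finite.exists_fin' R M
  classical
  obtain ⟨g, hg⟩ := Nat.find_spec hex
  refine ⟨_, g, hg, ?_⟩
  by_contra! hcon
  obtain ⟨l, hl, i, hi⟩ := hcon
  have hmin := fun m ↦ Nat.find_min (m := m) hex
  generalize Nat.find hex = b at *
  obtain _ | b := b
  · exact i.elim0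
  refine hmin b (Nat.lt_succ_self b)
    ⟨g ∘ₗ Function.ExtendByZero.linearMap R i.succAbove, fun m ↦ ?_⟩
  obtain ⟨v, rfl⟩ := hg m
  obtain ⟨c, hc⟩ := (notMem_maximalIdeal.1 hi).exists_left_inv
  refine ⟨(v - (v i * c) • l) ∘ i.succAbove, ?_⟩
  have : Function.ExtendByZero.linearMap R i.succAbove ((v - (v i * c) • l) ∘ i.succAbove) =
      v - (v i * c) • l := by
    funext j
    change Function.extend i.succAbove _ 0 j = _
    obtain rfl | ⟨j, rfl⟩ := i.eq_self_or_eq_succAbove j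
    · rw [Function.extend_apply' _ _ _ (by simp)]
      simp [mul_assoc, hc]
    · rw [Fin.succAbove_right_injective.extend_apply]
      rfl
  rw [LinearMap.comp_apply, this, map_sub, map_smul, hl,
    smul_zero, sub_zero]

variable {E : Type} [AddCommGroup E] [Module R E] [Module.Finite R E]

omit [Module.Finite R E] in
lemma extVanishes_dual {d : ℕ} (hEk : ∀ i < d, ExtVanishes R i (ResidueField R) E) (i : ℕ) :
    ∀ (L : Type) [AddCommGroup L] [Module R L] [Module.Finite R L], i < d →
      (∀ j, ExtVanishes R (j + 1) L E) → ExtVanishes R i (ResidueField R) (L →ₗ[R] E) := by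
  induction i with
  | zero =>
    intro L _ _ _ hd _
    rw [extVanishes_zero_iff]
    have h := hEk 0 hd
    rw [extVanishes_zero_iff] at h
    refine subsingleton_of_forall_eq 0 fun f ↦ LinearMap.ext fun κ ↦ LinearMap.ext fun l ↦ ?_
    exact LinearMap.congr_fun (h.elim (f.flip l) 0) κ
  | succ i ih =>
    intro L _ _ _ hd hL
    obtain ⟨b, π, hπ⟩ := Module.Finite.exists_fin' R L
    have hexact : Function.Exact (LinearMap.ker π).subtype π := LinearMap.exact_subtype_ker_map π
    have hinj := (LinearMap.ker π).subtype_injective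
    have h1 := ih (LinearMap.ker π) (by omega) fun j ↦
      (extVanishes_succ_of_projective j).left_sub hinj hexact hπ (hL (j + 1))
    exact h1.right_sub (LinearMap.lcomp_injective_of_surjective π hπ)
      (LinearMap.exact_lcomp_of_exact_of_surjective E hexact hπ)
      ((hL 0).exists_extend hinj hexact hπ) ((hEk _ hd).dual_right b)

end Dual

section Hull

open IsLocalRing

variable {R : Type} [CommRing R] {E : Type} [AddCommGroup E] [Module R E] {b r : ℕ}

/-- The map `h ↦ (h φ, h ∘ B)` whose cokernel is the middle term of the explicit hull. -/
def hullMap (E : Type) [AddCommGroup E] [Module R E] (B : (Fin b → R) →ₗ[R] (Fin r → R))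
    (φ : Fin r → R) : ((Fin r → R) →ₗ[R] E) →ₗ[R] E × ((Fin b → R) →ₗ[R] E) :=
  (LinearMap.applyₗ φ).prod (LinearMap.lcomp R E B)

/-- The middle term of the explicit hull. -/
abbrev HullY (E : Type) [AddCommGroup E] [Module R E] (B : (Fin b → R) →ₗ[R] (Fin r → R))
    (φ : Fin r → R) : Type :=
  (E × ((Fin b → R) →ₗ[R] E)) ⧸ LinearMap.range (hullMap E B φ)

/-- Restriction of functionals to the second syzygy. -/
def hullRes (E : Type) [AddCommGroup E] [Module R E] (B : (Fin b → R) →ₗ[R] (Fin r → R)) :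
    ((Fin b → R) →ₗ[R] E) →ₗ[R] (LinearMap.ker B →ₗ[R] E) :=
  LinearMap.lcomp R E (LinearMap.ker B).subtype

/-- The projection of the explicit hull. -/
def hullProj (E : Type) [AddCommGroup E] [Module R E] (B : (Fin b → R) →ₗ[R] (Fin r → R))
    (φ : Fin r → R) : HullY E B φ →ₗ[R] (LinearMap.ker B →ₗ[R] E) :=
  (LinearMap.range (hullMap E B φ)).liftQ (hullRes E B ∘ₗ LinearMap.snd R _ _) (by
    rintro _ ⟨h, rfl⟩
    exact LinearMap.ext fun l ↦ (congrArg h l.2).trans (map_zero h))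

variable {B : (Fin b → R) →ₗ[R] (Fin r → R)} {q : (Fin r → R) →ₗ[R] E} {φ : Fin r → R}
  (hq : Function.Surjective q) (hBq : Function.Exact B q)

/-- The inclusion of the explicit hull. -/
def hullIncl (hBq : Function.Exact B q) {S : Submodule R E} (hS : S = R ∙ q φ) :
    (E ⧸ S) →ₗ[R] HullY E B φ :=
  S.liftQ ((LinearMap.range (hullMap E B φ)).mkQ ∘ₗ LinearMap.inl R _ _) (by
    rintro w hw
    rw [hS, Submodule.mem_span_singleton] at hw
    obtain ⟨a, rfl⟩ := hw
    refine (Submodule.Quotient.mk_eq_zero _).2 ⟨a • q, Prod.ext rfl (LinearMap.ext fun l ↦ ?_)⟩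
    change a • q (B l) = 0
    rw [hBq.apply_apply_eq_zero, smul_zero])

include hq in
lemma hullIncl_injective (hEnd : ∀ f : E →ₗ[R] E, ∃ a : R, f = a • LinearMap.id) {S : Submodule R E}
    (hS : S = R ∙ q φ) : Function.Injective (hullIncl hBq hS) := by
  rw [← LinearMap.ker_eq_bot, LinearMap.ker_eq_bot']
  intro m hm
  obtain ⟨c, rfl⟩ := S.mkQ_surjective m
  obtain ⟨h, hh⟩ := (Submodule.Quotient.mk_eq_zero _).1 hm
  obtain ⟨s, hs⟩ := (LinearMap.exact_lcomp_of_exact_of_surjective E hBq hq h).1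
    (congrArg Prod.snd hh)
  obtain ⟨a, rfl⟩ := hEnd s
  refine (Submodule.Quotient.mk_eq_zero _).2 ?_
  rw [hS, Submodule.mem_span_singleton]
  refine ⟨a, ?_⟩
  have h1 : h φ = c := congrArg Prod.fst hh
  rw [← h1, ← hs]
  rfl

include hq hBq in
lemma hullMap_injective (hEnd : ∀ f : E →ₗ[R] E, ∃ a : R, f = a • LinearMap.id)
    (hφ : ∀ a : R, a • q φ = 0 → a = 0) : Function.Injective (hullMap E B φ) := by
  rw [← LinearMap.ker_eq_bot, LinearMap.ker_eq_bot']
  intro h hh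
  obtain ⟨s, rfl⟩ := (LinearMap.exact_lcomp_of_exact_of_surjective E hBq hq h).1
    (congrArg Prod.snd hh)
  obtain ⟨a, rfl⟩ := hEnd s
  rw [hφ a (congrArg Prod.fst hh), zero_smul, map_zero]

lemma exact_rangeRestrict_subtype (B : (Fin b → R) →ₗ[R] (Fin r → R)) :
    Function.Exact (LinearMap.ker B).subtype B.rangeRestrict := by
  intro l
  rw [← LinearMap.mem_ker, LinearMap.ker_rangeRestrict]
  simp

lemma exact_range_subtype (hBq : Function.Exact B q) :
    Function.Exact (LinearMap.range B).subtype q := by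
  intro l
  rw [hBq l]
  simp

section Ext

variable (hE : ∀ i, ExtVanishes R (i + 1) E E)
include hq hBq hE

lemma extVanishes_range (j : ℕ) : ExtVanishes R (j + 1) (LinearMap.range B) E :=
  (extVanishes_succ_of_projective j).left_sub (LinearMap.range B).subtype_injective
    (exact_range_subtype hBq) hq (hE (j + 1))

lemma extVanishes_ker (j : ℕ) : ExtVanishes R (j + 1) (LinearMap.ker B) E :=
  (extVanishes_succ_of_projective j).left_sub (LinearMap.ker B).subtype_injective
    (exact_rangeRestrict_subtype B) B.surjective_rangeRestrict (extVanishes_range hq hBq hE (j + 1))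

lemma hullRes_surjective : Function.Surjective (hullRes E B) :=
  (extVanishes_range hq hBq hE 0).exists_extend (LinearMap.ker B).subtype_injective
    (exact_rangeRestrict_subtype B) B.surjective_rangeRestrict

lemma hullProj_surjective : Function.Surjective (hullProj E B φ) := by
  intro ξ
  obtain ⟨η, rfl⟩ := hullRes_surjective hq hBq hE ξ
  exact ⟨Submodule.Quotient.mk (0, η), rfl⟩

lemma exact_hullIncl_hullProj {S : Submodule R E} (hS : S = R ∙ q φ) :
    Function.Exact (hullIncl hBq hS) (hullProj E B φ) := by
  intro y
  constructor
  · intro hy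
    obtain ⟨⟨c, η⟩, rfl⟩ := Submodule.mkQ_surjective _ y
    obtain ⟨θ, hθ⟩ := (LinearMap.exact_lcomp_of_exact_of_surjective E
      (exact_rangeRestrict_subtype B) B.surjective_rangeRestrict η).1 hy
    obtain ⟨h, rfl⟩ := (hE 0).exists_extend (LinearMap.range B).subtype_injective
      (exact_range_subtype hBq) hq θ
    refine ⟨Submodule.Quotient.mk (c - h φ), ?_⟩
    refine (Submodule.Quotient.eq _).2 ⟨-h, ?_⟩
    refine Prod.ext ?_ ?_
    · change -h φ = c - h φ - c
      abel
    · change -(h ∘ₗ B) = 0 - η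
      rw [zero_sub, ← hθ]
      rfl
  · rintro ⟨m, rfl⟩
    obtain ⟨c, rfl⟩ := S.mkQ_surjective m
    exact map_zero (hullRes E B)

end Ext

section Local

variable [IsLocalRing R] (hE : ∀ i, ExtVanishes R (i + 1) E E)
  (hEnd : ∀ f : E →ₗ[R] E, ∃ a : R, f = a • LinearMap.id)
  (hφ : ∀ a : R, a • q φ = 0 → a = 0)
  (hB : ∀ l, B l = 0 → ∀ i, l i ∈ maximalIdeal R)
include hq hBq hE hEnd hφ hB

lemma apply_mem_smul_top (u : (LinearMap.ker B →ₗ[R] E) →ₗ[R] E) (ξ : LinearMap.ker B →ₗ[R] E) :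
    u ξ ∈ (maximalIdeal R • ⊤ : Submodule R E) := by
  obtain ⟨η, rfl⟩ := hullRes_surjective hq hBq hE ξ
  choose l hl using fun i ↦ hEnd (u ∘ₗ hullRes E B ∘ₗ (piDualEquiv R E b).toLinearMap ∘ₗ
    LinearMap.single R (fun _ ↦ E) i)
  have key : ∀ η, u (hullRes E B η) = η l := by
    intro η
    obtain ⟨v, rfl⟩ := (piDualEquiv R E b).surjective η
    have : ∀ i, u (hullRes E B (piDualEquiv R E b (Pi.single i (v i)))) = l i • v i := fun i ↦
      LinearMap.congr_fun (hl i) (v i)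
    conv_lhs => rw [← Finset.univ_sum_single v, map_sum, map_sum, map_sum]
    simp only [this]
    simp [piDualEquiv, Module.Basis.constr_apply_fintype]
  have hBl : B l = 0 := by
    funext i
    refine hφ _ ?_
    have := key ((LinearMap.toSpanSingleton R E (q φ) ∘ₗ LinearMap.proj i) ∘ₗ B)
    rw [show hullRes E B ((LinearMap.toSpanSingleton R E (q φ) ∘ₗ LinearMap.proj i) ∘ₗ B) = 0 from
      LinearMap.ext fun m ↦ by simp [hullRes], map_zero] at this
    exact this.symm
  rw [key]
  obtain ⟨v, rfl⟩ := (piDualEquiv R E b).surjective η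
  rw [show piDualEquiv R E b v l = ∑ i, l i • v i by
    simp [piDualEquiv, Module.Basis.constr_apply_fintype]]
  exact Submodule.sum_mem _ fun i _ ↦ Submodule.smul_mem_smul (hB l hBl i) trivial

lemma hullRes_apply_mem_smul_top
    (t : (LinearMap.ker B →ₗ[R] E) →ₗ[R] ((Fin b → R) →ₗ[R] E)) (ξ : LinearMap.ker B →ₗ[R] E) :
    hullRes E B (t ξ) ∈ (maximalIdeal R • ⊤ : Submodule R (LinearMap.ker B →ₗ[R] E)) := by
  obtain ⟨v, hv⟩ := (piDualEquiv R E b).surjective (t ξ)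
  rw [← hv, ← Finset.univ_sum_single v, map_sum, map_sum]
  refine Submodule.sum_mem _ fun i _ ↦ ?_
  have h1 : v i ∈ (maximalIdeal R • ⊤ : Submodule R E) := by
    have h2 := apply_mem_smul_top hq hBq hE hEnd hφ hB
      (LinearMap.proj i ∘ₗ (piDualEquiv R E b).symm.toLinearMap ∘ₗ t) ξ
    simpa [← hv] using h2
  have h3 := Submodule.mem_map_of_mem (f := hullRes E B ∘ₗ (piDualEquiv R E b).toLinearMap ∘ₗ
    LinearMap.single R (fun _ ↦ E) i) h1
  rw [Submodule.map_smul''] at h3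
  exact Submodule.smul_mono le_rfl le_top h3

lemma hullProj_apply_mem_smul_top
    (h1 : ExtVanishes R 1 (LinearMap.ker B →ₗ[R] E) E)
    (t : (LinearMap.ker B →ₗ[R] E) →ₗ[R] HullY E B φ) (ξ : LinearMap.ker B →ₗ[R] E) :
    hullProj E B φ (t ξ) ∈ (maximalIdeal R • ⊤ : Submodule R (LinearMap.ker B →ₗ[R] E)) := by
  obtain ⟨t, rfl⟩ := (h1.dual_right r).exists_lift (hullMap_injective hq hBq hEnd hφ)
    (LinearMap.exact_map_mkQ_range _) (Submodule.mkQ_surjective _) t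
  exact hullRes_apply_mem_smul_top hq hBq hE hEnd hφ hB (LinearMap.snd R _ _ ∘ₗ t) ξ

end Local

end Hull

section Uniqueness

open IsLocalRing

variable {R : Type} [CommRing R] [IsLocalRing R]
  {M Y X Y₀ X₀ : Type} [AddCommGroup M] [Module R M] [AddCommGroup Y] [Module R Y]
  [AddCommGroup X] [Module R X] [AddCommGroup Y₀] [Module R Y₀] [AddCommGroup X₀] [Module R X₀]

/-- An endomorphism of a finite module that is the identity modulo the maximal ideal is
bijective. -/
lemma bijective_id_add_of_mem_smul_top [Module.Finite R X₀] (γ : X₀ →ₗ[R] X₀)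
    (hγ : ∀ ξ, γ ξ ∈ (maximalIdeal R • ⊤ : Submodule R X₀)) :
    Function.Bijective (LinearMap.id + γ : X₀ →ₗ[R] X₀) := by
  have hs : Function.Surjective (LinearMap.id + γ : X₀ →ₗ[R] X₀) := by
    rw [← LinearMap.range_eq_top, eq_top_iff]
    refine Submodule.le_of_le_smul_of_le_jacobson_bot Module.Finite.fg_top
      (maximalIdeal_le_jacobson ⊥) fun ξ _ ↦ ?_
    rw [← add_sub_cancel_right ξ (γ ξ)]
    exact Submodule.sub_mem _ (Submodule.mem_sup_left ⟨ξ, rfl⟩) (Submodule.mem_sup_right (hγ ξ))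
  exact ⟨OrzechProperty.injective_of_surjective_endomorphism _ hs, hs⟩

/-- If `0 → M → Y → X → 0` has no common direct summand and `0 → M → Y₀ → X₀ → 0` is such that
every composite `X₀ → Y₀ → X₀` is zero modulo the maximal ideal, then `X ≃ X₀`. -/
theorem nonempty_linearEquiv_of_not_hasCommonSummandVia [Module.Finite R X₀]
    {ι : M →ₗ[R] Y} {π : Y →ₗ[R] X} (hι : Function.Injective ι) (hιπ : Function.Exact ι π)
    (hπ : Function.Surjective π)
    (hmin : ¬ HasCommonSummandVia R (Y := ModuleCat.of R Y) (X := ModuleCat.of R X) π)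
    {ι₀ : M →ₗ[R] Y₀} {π₀ : Y₀ →ₗ[R] X₀} (hι₀ : Function.Injective ι₀)
    (hιπ₀ : Function.Exact ι₀ π₀) (hπ₀ : Function.Surjective π₀)
    (h₁ : ExtVanishes R 1 X Y₀) (h₂ : ExtVanishes R 1 X₀ Y)
    (hmin₀ : ∀ (t : X₀ →ₗ[R] Y₀) (ξ : X₀), π₀ (t ξ) ∈ (maximalIdeal R • ⊤ : Submodule R X₀)) :
    Nonempty (X ≃ₗ[R] X₀) := by
  obtain ⟨α, hα⟩ := h₁.exists_extend hι hιπ hπ ι₀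
  obtain ⟨β, hβ⟩ := h₂.exists_extend hι₀ hιπ₀ hπ₀ ι
  have hα' : ∀ m, α (ι m) = ι₀ m := LinearMap.congr_fun hα
  have hβ' : ∀ m, β (ι₀ m) = ι m := LinearMap.congr_fun hβ
  obtain ⟨t, ht⟩ := (LinearMap.exact_lcomp_of_exact_of_surjective Y₀ hιπ₀ hπ₀
    (α ∘ₗ β - LinearMap.id)).1 (LinearMap.ext fun m ↦ by simp [hα', hβ'])
  have ht' : ∀ y, α (β y) = y + t (π₀ y) := fun y ↦ by
    have : t (π₀ y) = α (β y) - y := LinearMap.congr_fun ht y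
    rw [this]; abel
  have hγ := bijective_id_add_of_mem_smul_top (π₀ ∘ₗ t) (hmin₀ t)
  have hγ' : ∀ y, π₀ (α (β y)) = (LinearMap.id + π₀ ∘ₗ t : X₀ →ₗ[R] X₀) (π₀ y) := fun y ↦ by
    simp [ht']
  have hbij : Function.Bijective (α ∘ₗ β) := by
    constructor
    · rw [← LinearMap.ker_eq_bot, LinearMap.ker_eq_bot']
      intro y hy
      have hy' : α (β y) = 0 := hy
      have h0 : π₀ y = 0 := hγ.1 (by rw [← hγ', hy', map_zero, map_zero])
      rw [ht', h0, map_zero, add_zero] at hy'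
      exact hy'
    · intro y
      obtain ⟨ξ, hξ⟩ := hγ.2 (π₀ y)
      obtain ⟨z, rfl⟩ := hπ₀ ξ
      obtain ⟨m, hm⟩ := (hιπ₀ (y - α (β z))).1 (by rw [map_sub, hγ', hξ, sub_self])
      refine ⟨z + ι₀ m, ?_⟩
      change α (β (z + ι₀ m)) = y
      rw [map_add, map_add, hβ', hα', hm]
      abel
  let σ : Y₀ ≃ₗ[R] Y₀ := LinearEquiv.ofBijective _ hbij
  have hσ : ∀ y, α (β (σ.symm y)) = y := σ.apply_symm_apply
  have hσι : ∀ m, σ.symm (ι₀ m) = ι₀ m := fun m ↦ by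
    rw [LinearEquiv.symm_apply_eq]
    change _ = α (β (ι₀ m))
    rw [hβ', hα']
  let P : Y →ₗ[R] LinearMap.ker α := (LinearMap.id - β ∘ₗ σ.symm.toLinearMap ∘ₗ α).codRestrict _
    fun y ↦ by simp [hσ]
  have hP : ∀ y, (P y : Y) = y - β (σ.symm (α y)) := fun y ↦ rfl
  have hPker : ∀ y : LinearMap.ker α, P y = y := fun y ↦ Subtype.ext <| by
    rw [hP, LinearMap.mem_ker.1 y.2, map_zero, map_zero, sub_zero]
  have hPι : ∀ m, P (ι m) = 0 := fun m ↦ Subtype.ext <| by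
    rw [hP, hα', hσι, hβ', sub_self]; rfl
  obtain ⟨P', hP'⟩ := (LinearMap.exact_lcomp_of_exact_of_surjective _ hιπ hπ P).1
    (LinearMap.ext hPι)
  obtain ⟨α', hα''⟩ := (LinearMap.exact_lcomp_of_exact_of_surjective _ hιπ hπ (π₀ ∘ₗ α)).1
    (LinearMap.ext fun m ↦ by
      change π₀ (α (ι m)) = 0
      rw [hα', hιπ₀.apply_apply_eq_zero])
  have hP'' : ∀ y, P' (π y) = P y := LinearMap.congr_fun hP'
  have hα₃ : ∀ y, α' (π y) = π₀ (α y) := LinearMap.congr_fun hα''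
  have he : Function.Bijective (P.prod α) := by
    constructor
    · rw [← LinearMap.ker_eq_bot, LinearMap.ker_eq_bot']
      intro y hy
      have h1 : P y = 0 := congrArg Prod.fst hy
      have h2 : α y = 0 := congrArg Prod.snd hy
      have h3 := hP y
      rw [h1, h2, map_zero, map_zero, sub_zero] at h3
      exact h3.symm
    · rintro ⟨n, y⟩
      refine ⟨n + β (σ.symm y), Prod.ext ?_ ?_⟩
      · change P (n + β (σ.symm y)) = n
        rw [map_add, hPker, add_eq_left]
        exact Subtype.ext (by rw [hP, hσ, sub_self]; rfl)
      · change α (n + β (σ.symm y)) = y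
        rw [map_add, LinearMap.mem_ker.1 n.2, zero_add, hσ]
  have hf : Function.Bijective (P'.prod α') := by
    constructor
    · rw [← LinearMap.ker_eq_bot, LinearMap.ker_eq_bot']
      intro ξ hξ
      obtain ⟨y, rfl⟩ := hπ ξ
      have h1 : P' (π y) = 0 := congrArg Prod.fst hξ
      have h2 : α' (π y) = 0 := congrArg Prod.snd hξ
      rw [hP''] at h1
      rw [hα₃] at h2
      obtain ⟨m, hm⟩ := (hιπ₀ _).1 h2
      have : y = ι m := he.1 (Prod.ext (h1.trans (hPι m).symm) (hm.symm.trans (hα' m).symm))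
      rw [this, hιπ.apply_apply_eq_zero]
    · rintro ⟨n, ξ⟩
      obtain ⟨z, rfl⟩ := hπ₀ ξ
      obtain ⟨y, hy⟩ := he.2 (n, z)
      refine ⟨π y, Prod.ext ?_ ?_⟩
      · exact (hP'' y).trans (congrArg Prod.fst hy)
      · exact (hα₃ y).trans (congrArg (fun p ↦ π₀ p.2) hy)
  have hN : Subsingleton (LinearMap.ker α) := by
    by_contra hN
    rw [not_subsingleton_iff_nontrivial] at hN
    exact hmin ⟨ModuleCat.of R (LinearMap.ker α), ModuleCat.of R Y₀, ModuleCat.of R X₀, hN,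
      LinearEquiv.ofBijective _ he, LinearEquiv.ofBijective _ hf, π₀,
      fun y ↦ Prod.ext (hP'' y) (hα₃ y)⟩
  refine ⟨LinearEquiv.ofBijective α' ⟨?_, ?_⟩⟩
  · exact fun a b hab ↦ hf.1 (Prod.ext (Subsingleton.elim _ _) hab)
  · intro ξ
    obtain ⟨a, ha⟩ := hf.2 (0, ξ)
    exact ⟨a, congrArg Prod.snd ha⟩

end Uniqueness

section Canonical

open IsLocalRing

variable {R : Type} [CommRing R] [IsLocalRing R]

/-- The cokernel of the minimal hull of `E / Rc` does not depend on the faithful element `c`. -/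
theorem exists_forall_nonempty_linearEquiv [IsNoetherianRing R] {d : ℕ}
    (hR : ∀ i < d, ExtVanishes R i (ResidueField R) R)
    (hRd : ¬ ExtVanishes R d (ResidueField R) R)
    {E : Type} [AddCommGroup E] [Module R E] [Module.Finite R E]
    (hcomm : ∀ (f g : E →ₗ[R] E) (a : E), f (g a) = g (f a))
    (hE : ∃ n : ℕ, ∀ (N : Type) [AddCommGroup N] [Module R N] (i : ℕ), n < i → ExtVanishes R i N E)
    (hEk : ∀ i < d, ExtVanishes R i (ResidueField R) E)
    (hEd : ¬ ExtVanishes R d (ResidueField R) E) :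
    ∃ X₀ : ModuleCat.{0} R, ∀ c : E, (∀ a : R, a • c = 0 → a = 0) → ∀ S : Submodule R E,
      S = R ∙ c → ∀ (Y X : Type) [AddCommGroup Y] [Module R Y] [AddCommGroup X] [Module R X]
      [Module.Finite R Y] [Module.Finite R X] (ι : (E ⧸ S) →ₗ[R] Y) (π : Y →ₗ[R] X),
      (∃ n : ℕ, ∀ (N : Type) [AddCommGroup N] [Module R N] (i : ℕ), n < i → ExtVanishes R i N Y) →
      (∀ i < d, ExtVanishes R i (ResidueField R) X) →
      Function.Injective ι → Function.Exact ι π → Function.Surjective π →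
      ¬ HasCommonSummandVia R (Y := ModuleCat.of R Y) (X := ModuleCat.of R X) π →
      Nonempty (X ≃ₗ[R] X₀) := by
  have hEnd := exists_eq_smul_id hcomm hR hRd hE hEk hEd
  have hEE : ∀ i, ExtVanishes R (i + 1) E E := fun i ↦
    extVanishes_of_mcm hR hRd hE E hEk i.succ_pos
  obtain ⟨r, q, hq⟩ := Module.Finite.exists_fin' R E
  obtain ⟨b, g, hg, hgm⟩ := exists_minimal_generators (R := R) (LinearMap.ker q)
  let B : (Fin b → R) →ₗ[R] (Fin r → R) := (LinearMap.ker q).subtype ∘ₗ g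
  have hBq : Function.Exact B q := by
    intro l
    constructor
    · intro hl
      obtain ⟨z, hz⟩ := hg ⟨l, hl⟩
      exact ⟨z, congrArg Subtype.val hz⟩
    · rintro ⟨z, rfl⟩
      exact (g z).2
  have hB : ∀ l, B l = 0 → ∀ i, l i ∈ maximalIdeal R := fun l hl ↦ hgm l (Subtype.ext hl)
  have hX₀ : ∀ i < d, ExtVanishes R i (ResidueField R) (LinearMap.ker B →ₗ[R] E) := fun i hi ↦
    extVanishes_dual hEk i _ hi (extVanishes_ker hq hBq hEE)
  refine ⟨ModuleCat.of R (LinearMap.ker B →ₗ[R] E), ?_⟩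
  intro c hc S hS Y X _ _ _ _ _ _ ι π hY hX hι hιπ hπ hmin
  obtain ⟨φ, rfl⟩ := hq c
  have hXE : ∀ i, ExtVanishes R (i + 1) X E := fun i ↦
    extVanishes_of_mcm hR hRd hE X hX i.succ_pos
  refine nonempty_linearEquiv_of_not_hasCommonSummandVia hι hιπ hπ hmin
    (hullIncl_injective hq hBq hEnd hS) (exact_hullIncl_hullProj hq hBq hEE hS)
    (hullProj_surjective hq hBq hEE) ?_ (extVanishes_of_mcm hR hRd hY _ hX₀ one_pos)
    (hullProj_apply_mem_smul_top hq hBq hEE hEnd hc hB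
      (extVanishes_of_mcm hR hRd hE _ hX₀ one_pos))
  exact ExtVanishes.right_quot (hullMap_injective hq hBq hEnd hc)
    (LinearMap.exact_map_mkQ_range _) (Submodule.mkQ_surjective _)
    ((hXE 0).prod_right ((hXE 0).dual_right b)) ((hXE 1).dual_right r)

omit [IsLocalRing R] in
lemma HasFiniteInjDim.exists_extVanishes {Y : ModuleCat.{0} R} (h : HasFiniteInjDim R Y) :
    ∃ n : ℕ, ∀ (N : Type) [AddCommGroup N] [Module R N] (i : ℕ), n < i → ExtVanishes R i N Y := by
  obtain ⟨n, hn⟩ := h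
  exact ⟨n, fun N _ _ i hi ↦ (subsingleton_modExt_iff (ModuleCat.of R N) Y i).1 (hn _ i hi)⟩

lemma extVanishes_of_lt_moduleDepth {M : ModuleCat.{0} R} {i : ℕ} (h : (i : ℕ∞) < moduleDepth R M) :
    ExtVanishes R i (ResidueField R) M := by
  refine (subsingleton_modExt_iff (ModuleCat.of R (ResidueField R)) M i).1 ?_
  by_contra hi
  rw [not_subsingleton_iff_nontrivial] at hi
  exact h.not_ge (sInf_le ⟨i, rfl, hi⟩)

lemma not_extVanishes_of_moduleDepth_eq {M : ModuleCat.{0} R} {d : ℕ}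
    (h : moduleDepth R M = (d : ℕ∞)) : ¬ ExtVanishes R d (ResidueField R) M := by
  intro hd
  have hne : {n : ℕ∞ | ∃ m : ℕ, n = (m : ℕ∞) ∧
      Nontrivial (ModExt R m (ModuleCat.of R (ResidueField R)) M)}.Nonempty := by
    rw [Set.nonempty_iff_ne_empty]
    intro h0
    rw [moduleDepth, h0, sInf_empty] at h
    exact ENat.top_ne_natCast d h
  obtain ⟨m, hm, hm'⟩ := csInf_mem hne
  obtain rfl : d = m := Nat.cast_injective (h.symm.trans hm)
  exact not_subsingleton_iff_nontrivial.2 hm'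
    ((subsingleton_modExt_iff (ModuleCat.of R (ResidueField R)) M d).2 hd)

omit [IsLocalRing R] in
/-- Endomorphisms of an ideal containing a regular element commute. -/
lemma ideal_end_comm {I : Ideal R} {x : R} (hx : x ∈ I) (hreg : x ∈ nonZeroDivisors R)
    (f g : I →ₗ[R] I) (a : I) : f (g a) = g (f a) := by
  have key : ∀ (h : I →ₗ[R] I) (a : I), x • h a = (a : R) • h ⟨x, hx⟩ := fun h a ↦ by
    rw [← map_smul, ← map_smul]
    exact congrArg h (Subtype.ext (mul_comm x a))
  have inj : ∀ u v : I, x • u = x • v → u = v := fun u v huv ↦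
    Subtype.ext ((mul_cancel_left_mem_nonZeroDivisors hreg).1 (congrArg Subtype.val huv))
  refine inj _ _ (inj _ _ ?_)
  rw [key f (g a), key g (f a), smul_comm, smul_comm x]
  refine Subtype.ext ?_
  have h1 := congrArg Subtype.val (key f a)
  have h2 := congrArg Subtype.val (key g a)
  simp only [Submodule.coe_smul, smul_eq_mul] at h1 h2 ⊢
  linear_combination ((f ⟨x, hx⟩ : I) : R) * h2 - ((g ⟨x, hx⟩ : I) : R) * h1

lemma exists_forall_isMinFIDHull_nonempty_linearEquiv (hCM : IsCMLocalRing R) {ω : Ideal R}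
    (hω : IsCanonicalIdeal R ω) {x : R} (hxω : x ∈ ω) (hxreg : x ∈ nonZeroDivisors R) :
    ∃ X₀ : ModuleCat.{0} R, ∀ n : ℕ, 1 ≤ n →
      ∀ (Y X : ModuleCat R) (ι : (qmod R ω (Ideal.span {x ^ n})) →ₗ[R] Y) (π : Y →ₗ[R] X),
        IsMinFIDHull R (qmod R ω (Ideal.span {x ^ n})) Y X ι π → Nonempty (X ≃ₗ[R] X₀) := by
  have := hCM.1
  obtain ⟨_, hinj, d, hd, ⟨e⟩, hd'⟩ := hω
  have hdepth : moduleDepth R (ModuleCat.of R R) = (d : ℕ∞) := by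
    have := hCM.2.trans hd
    exact_mod_cast this
  have hV : ∀ i ≠ d, ExtVanishes R i (ResidueField R) ω := fun i hi ↦
    (subsingleton_modExt_iff (ModuleCat.of R (ResidueField R)) (ModuleCat.of R ω) i).1 (hd' i hi)
  obtain ⟨X₀, hX₀⟩ := exists_forall_nonempty_linearEquiv
    (fun i hi ↦ extVanishes_of_lt_moduleDepth (by rw [hdepth]; exact_mod_cast hi))
    (not_extVanishes_of_moduleDepth_eq hdepth) (ideal_end_comm hxω hxreg)
    (HasFiniteInjDim.exists_extVanishes hinj) (fun i hi ↦ hV i hi.ne) (fun h ↦ by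
      have := (subsingleton_modExt_iff (ModuleCat.of R (ResidueField R)) (ModuleCat.of R ω) d).2 h
      exact not_subsingleton (ResidueField R) e.symm.toEquiv.subsingleton)
  refine ⟨X₀, fun n hn Y X ι π h ↦ ?_⟩
  obtain ⟨⟨_, _, hY, hX, hι, hπ, hιπ⟩, hmin⟩ := h
  have hXk : ∀ i < d, ExtVanishes R i (ResidueField R) X := by
    rcases hX with hX | hX
    · refine fun i hi ↦ extVanishes_of_lt_moduleDepth ?_
      have hX' : moduleDepth R X = (d : ℕ∞) := by
        have := hX.2.trans hd
        exact_mod_cast this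
      rw [hX']
      exact_mod_cast hi
    · exact fun i _ ↦ extVanishes_of_subsingleton_right i
  have : Module.Finite R X := Module.Finite.of_surjective π hπ
  refine hX₀ ⟨x ^ n, Ideal.pow_mem_of_mem ω hxω n hn⟩ ?_ _ ?_ Y X ι π
    (HasFiniteInjDim.exists_extVanishes hY) hXk hι hιπ hπ hmin
  · intro a ha
    exact (mul_right_mem_nonZeroDivisors_eq_zero_iff (pow_mem hxreg n)).1 (congrArg Subtype.val ha)
  · ext u
    rw [Submodule.mem_comap, Ideal.mem_span_singleton', Submodule.mem_span_singleton]
    exact exists_congr fun a ↦ ⟨fun h ↦ Subtype.ext h, fun h ↦ congrArg Subtype.val h⟩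

end Canonical

end FIDHull


theorem stmt4 (R : Type) [CommRing R] [IsLocalRing R]
    (hCM : IsCMLocalRing R) (hGG : IsGenericallyGorenstein R)
    (hnG : ¬ IsGorensteinLocalRing R)
    (ω : Ideal R) (hω : IsCanonicalIdeal R ω)
    (x : R) (hxω : x ∈ ω) (hxreg : x ∈ nonZeroDivisors R) :
    (∀ m n : ℕ, 1 ≤ m → 1 ≤ n →
      ∀ (Ym Xm : ModuleCat R) (ιm : (qmod R ω (Ideal.span {x ^ m})) →ₗ[R] Ym) (πm : Ym →ₗ[R] Xm),
        IsMinFIDHull R (qmod R ω (Ideal.span {x ^ m})) Ym Xm ιm πm →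
      ∀ (Yn Xn : ModuleCat R) (ιn : (qmod R ω (Ideal.span {x ^ n})) →ₗ[R] Yn) (πn : Yn →ₗ[R] Xn),
        IsMinFIDHull R (qmod R ω (Ideal.span {x ^ n})) Yn Xn ιn πn →
        WStablyIso R (ModuleCat.of R ↥ω) Xm Xn) ∧
    (∃ N : ℕ, 1 ≤ N ∧ ∀ m n : ℕ, N ≤ m → N ≤ n →
      ∀ (Ym Xm : ModuleCat R) (ιm : (qmod R ω (Ideal.span {x ^ m})) →ₗ[R] Ym) (πm : Ym →ₗ[R] Xm),
        IsMinFIDHull R (qmod R ω (Ideal.span {x ^ m})) Ym Xm ιm πm →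
      ∀ (Yn Xn : ModuleCat R) (ιn : (qmod R ω (Ideal.span {x ^ n})) →ₗ[R] Yn) (πn : Yn →ₗ[R] Xn),
        IsMinFIDHull R (qmod R ω (Ideal.span {x ^ n})) Yn Xn ιn πn →
        Nonempty (Xm ≃ₗ[R] Xn)) := by
  obtain ⟨X₀, hX₀⟩ :=
    FIDHull.exists_forall_isMinFIDHull_nonempty_linearEquiv hCM hω hxω hxreg
  constructor
  · intro m n hm hn Ym Xm ιm πm hhm Yn Xn ιn πn hhn
    obtain ⟨e⟩ := hX₀ m hm Ym Xm ιm πm hhm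
    obtain ⟨f⟩ := hX₀ n hn Yn Xn ιn πn hhn
    exact ⟨0, 0, ⟨(e.trans f.symm).prodCongr (LinearEquiv.refl R _)⟩⟩
  · refine ⟨1, le_rfl, fun m n hm hn Ym Xm ιm πm hhm Yn Xn ιn πn hhn ↦ ?_⟩
    obtain ⟨e⟩ := hX₀ m hm Ym Xm ιm πm hhm
    obtain ⟨f⟩ := hX₀ n hn Yn Xn ιn πn hhn
    exact ⟨e.trans f.symm⟩

end
end

section
/- Let (R,𝔪) be a Cohen-Macaulay local ring with canonical module that is generically Gorenstein and not Gorenstein, let ω be a canonical ideal of R, let x ∈ ω be an R-regular element, and for a module M set M^∨ := Ext^1_R(M, ω). Then X^{(ω/x^mR)^∨} ≅_ω X^{(ω/x^nR)^∨} for all m, n ≥ 1, and moreover there exists N ≥ 1 such that X^{(ω/x^mR)^∨} ≅ X^{(ω/x^nR)^∨} for all m, n ≥ N. Here X^M denotes the MCM part of the minimal FID hull of M. -/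
open CategoryTheory

noncomputable section

section ExtVanishing

variable {R : Type} [CommRing R]

/-- Vanishing of `Ext^i_R(A, B)` for unbundled modules. -/
def ExtZero (R : Type) [CommRing R] (i : ℕ) (A B : Type) [AddCommGroup A] [Module R A]
    [AddCommGroup B] [Module R B] : Prop :=
  Subsingleton (Abelian.Ext (ModuleCat.of R A) (ModuleCat.of R B) i)

variable {A B C A' Y : Type} [AddCommGroup A] [Module R A] [AddCommGroup B] [Module R B]
  [AddCommGroup C] [Module R C] [AddCommGroup A'] [Module R A'] [AddCommGroup Y] [Module R Y]

lemma ExtZero.eq_zero {i : ℕ} (h : ExtZero R i A B)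
    (e : Abelian.Ext (ModuleCat.of R A) (ModuleCat.of R B) i) : e = 0 :=
  @Subsingleton.elim _ h _ _

lemma ExtZero.of_forall {i : ℕ}
    (h : ∀ e : Abelian.Ext (ModuleCat.of R A) (ModuleCat.of R B) i, e = 0) : ExtZero R i A B :=
  ⟨fun a b => (h a).trans (h b).symm⟩

lemma extZero_zero_iff : ExtZero R 0 A B ↔ Subsingleton (A →ₗ[R] B) :=
  (Abelian.Ext.addEquiv₀.subsingleton_congr).trans
    (ModuleCat.homAddEquiv (M := ModuleCat.of R A) (N := ModuleCat.of R B)).subsingleton_congr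

lemma extZero_succ_of_projective [Module.Projective R A] (n : ℕ) : ExtZero R (n + 1) A B :=
  have : Projective (ModuleCat.of R A) := (IsProjective.iff_projective A).mp inferInstance
  .of_forall fun e => Abelian.Ext.eq_zero_of_projective e

lemma extZero_of_linearEquiv_left {i : ℕ} (e : A ≃ₗ[R] A') (h : ExtZero R i A B) :
    ExtZero R i A' B := by
  refine .of_forall fun z => ?_
  have h1 : (Abelian.Ext.mk₀ e.toModuleIso.inv).comp
      ((Abelian.Ext.mk₀ e.toModuleIso.hom).comp z (zero_add i)) (zero_add i) = z := by
    rw [Abelian.Ext.mk₀_comp_mk₀_assoc, Iso.inv_hom_id, Abelian.Ext.mk₀_id_comp]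
  rw [← h1, h.eq_zero ((Abelian.Ext.mk₀ e.toModuleIso.hom).comp z (zero_add i)),
    Abelian.Ext.comp_zero]

lemma extZero_of_linearEquiv_right {i : ℕ} (e : B ≃ₗ[R] C) (h : ExtZero R i A B) :
    ExtZero R i A C := by
  refine .of_forall fun z => ?_
  have h1 : (z.comp (Abelian.Ext.mk₀ e.toModuleIso.inv) (add_zero i)).comp
      (Abelian.Ext.mk₀ e.toModuleIso.hom) (add_zero i) = z := by
    rw [Abelian.Ext.comp_assoc_of_third_deg_zero, Abelian.Ext.mk₀_comp_mk₀, Iso.inv_hom_id, Abelian.Ext.comp_mk₀_id]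
  rw [← h1, h.eq_zero (z.comp (Abelian.Ext.mk₀ e.toModuleIso.inv) (add_zero i)),
    Abelian.Ext.zero_comp]

lemma extZero_of_subsingleton_left [Subsingleton A] (i : ℕ) : ExtZero R i A B := by
  refine .of_forall fun z => ?_
  have h0 : 𝟙 (ModuleCat.of R A) = 0 := by
    ext a; exact Subsingleton.elim (α := A) _ _
  rw [← Abelian.Ext.mk₀_id_comp z, h0, Abelian.Ext.mk₀_zero, Abelian.Ext.zero_comp]

lemma extZero_of_subsingleton_right [Subsingleton B] (i : ℕ) : ExtZero R i A B := by
  refine .of_forall fun z => ?_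
  have h0 : 𝟙 (ModuleCat.of R B) = 0 := by
    ext a; exact Subsingleton.elim (α := B) _ _
  rw [← Abelian.Ext.comp_mk₀_id z, h0, Abelian.Ext.mk₀_zero, Abelian.Ext.comp_zero]

/-- The short complex attached to an exact pair of linear maps. -/
abbrev exactPair (f : A →ₗ[R] B) (g : B →ₗ[R] C) (h : Function.Exact f g) :
    ShortComplex (ModuleCat.{0} R) :=
  ModuleCat.shortComplexOfCompEqZero f g h.linearMap_comp_eq_zero

variable {f : A →ₗ[R] B} {g : B →ₗ[R] C}

lemma exactPair_shortExact (hf : Function.Injective f) (hg : Function.Surjective g)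
    (h : Function.Exact f g) : (exactPair f g h).ShortExact :=
  ModuleCat.shortComplex_shortExact _ h hf hg

section LongExact

variable (hf : Function.Injective f) (hg : Function.Surjective g) (h : Function.Exact f g)
include hf hg h

lemma extZero_left_mid {i : ℕ} (hA : ExtZero R i A Y) (hC : ExtZero R i C Y) :
    ExtZero R i B Y := by
  refine .of_forall fun z => ?_
  obtain ⟨w, hw⟩ := Abelian.Ext.contravariant_sequence_exact₂ (exactPair_shortExact hf hg h)
    (ModuleCat.of R Y) z (hA.eq_zero _)
  rw [← hw, hC.eq_zero w, Abelian.Ext.comp_zero]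

lemma extZero_left_fst {i : ℕ} (hB : ExtZero R i B Y) (hC : ExtZero R (i + 1) C Y) :
    ExtZero R i A Y := by
  refine .of_forall fun z => ?_
  obtain ⟨w, hw⟩ := Abelian.Ext.contravariant_sequence_exact₁ (exactPair_shortExact hf hg h)
    (ModuleCat.of R Y) z (add_comm 1 i) (hC.eq_zero _)
  rw [← hw, hB.eq_zero w, Abelian.Ext.comp_zero]

lemma extZero_left_snd {i : ℕ} (hB : ExtZero R (i + 1) B Y) (hA : ExtZero R i A Y) :
    ExtZero R (i + 1) C Y := by
  refine .of_forall fun z => ?_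
  obtain ⟨w, hw⟩ := Abelian.Ext.contravariant_sequence_exact₃ (exactPair_shortExact hf hg h)
    (ModuleCat.of R Y) z (hB.eq_zero _) (add_comm 1 i)
  rw [← hw, hA.eq_zero w, Abelian.Ext.comp_zero]

lemma extZero_right_mid {i : ℕ} (hA : ExtZero R i Y A) (hC : ExtZero R i Y C) :
    ExtZero R i Y B := by
  refine .of_forall fun z => ?_
  obtain ⟨w, hw⟩ := Abelian.Ext.covariant_sequence_exact₂
    (ModuleCat.of R Y) (exactPair_shortExact hf hg h) z (hC.eq_zero _)
  rw [← hw, hA.eq_zero w, Abelian.Ext.zero_comp]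

lemma extZero_right_snd {i : ℕ} (hB : ExtZero R i Y B) (hA : ExtZero R (i + 1) Y A) :
    ExtZero R i Y C := by
  refine .of_forall fun z => ?_
  obtain ⟨w, hw⟩ := Abelian.Ext.covariant_sequence_exact₃
    (ModuleCat.of R Y) (exactPair_shortExact hf hg h) z rfl (hA.eq_zero _)
  rw [← hw, hB.eq_zero w, Abelian.Ext.zero_comp]

lemma extZero_right_fst {i : ℕ} (hB : ExtZero R (i + 1) Y B) (hC : ExtZero R i Y C) :
    ExtZero R (i + 1) Y A := by
  refine .of_forall fun z => ?_
  obtain ⟨w, hw⟩ := Abelian.Ext.covariant_sequence_exact₁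
    (ModuleCat.of R Y) (exactPair_shortExact hf hg h) z (hB.eq_zero _) rfl
  rw [← hw, hC.eq_zero w, Abelian.Ext.zero_comp]

lemma exists_extend_of_extZero (hC : ExtZero R 1 C Y) (u : A →ₗ[R] Y) :
    ∃ v : B →ₗ[R] Y, v ∘ₗ f = u := by
  obtain ⟨w, hw⟩ := Abelian.Ext.contravariant_sequence_exact₁ (exactPair_shortExact hf hg h)
    (ModuleCat.of R Y) (Abelian.Ext.mk₀ (ModuleCat.ofHom u)) (add_zero 1) (hC.eq_zero _)
  obtain ⟨v, rfl⟩ := Abelian.Ext.addEquiv₀.symm.surjective w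
  change (Abelian.Ext.mk₀ _).comp (Abelian.Ext.mk₀ v) _ = _ at hw
  rw [Abelian.Ext.mk₀_comp_mk₀] at hw
  have h2 := Abelian.Ext.addEquiv₀.symm.injective hw
  exact ⟨v.hom, congrArg ModuleCat.Hom.hom h2⟩

lemma exists_lift_of_extZero (hA : ExtZero R 1 Y A) (u : Y →ₗ[R] C) :
    ∃ v : Y →ₗ[R] B, g ∘ₗ v = u := by
  obtain ⟨w, hw⟩ := Abelian.Ext.covariant_sequence_exact₃
    (ModuleCat.of R Y) (exactPair_shortExact hf hg h) (Abelian.Ext.mk₀ (ModuleCat.ofHom u))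
    (zero_add 1) (hA.eq_zero _)
  obtain ⟨v, rfl⟩ := Abelian.Ext.addEquiv₀.symm.surjective w
  change (Abelian.Ext.mk₀ v).comp (Abelian.Ext.mk₀ _) _ = _ at hw
  rw [Abelian.Ext.mk₀_comp_mk₀] at hw
  have h2 := Abelian.Ext.addEquiv₀.symm.injective hw
  exact ⟨v.hom, congrArg ModuleCat.Hom.hom h2⟩

lemma extZero_one_of_forall_extend (hB : ExtZero R 1 B Y)
    (hext : ∀ u : A →ₗ[R] Y, ∃ v : B →ₗ[R] Y, v ∘ₗ f = u) : ExtZero R 1 C Y := by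
  refine .of_forall fun z => ?_
  have hS := exactPair_shortExact hf hg h
  obtain ⟨w, hw⟩ := Abelian.Ext.contravariant_sequence_exact₃ hS
    (ModuleCat.of R Y) z (hB.eq_zero _) (add_zero 1)
  obtain ⟨u, rfl⟩ := Abelian.Ext.addEquiv₀.symm.surjective w
  obtain ⟨v, hv⟩ := hext u.hom
  have hu : u = (exactPair f g h).f ≫ ModuleCat.ofHom v := by
    ext a; exact (LinearMap.congr_fun hv a).symm
  have h3 : Abelian.Ext.addEquiv₀.symm u = (Abelian.Ext.mk₀ (exactPair f g h).f).comp
      (Abelian.Ext.mk₀ (ModuleCat.ofHom v)) (zero_add 0) := by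
    rw [Abelian.Ext.mk₀_comp_mk₀, ← hu]; rfl
  rw [← hw, h3, hS.extClass_comp_assoc]

end LongExact

lemma exact_smul_mkQ (y : R) (N : Type) [AddCommGroup N] [Module R N] :
    Function.Exact (LinearMap.lsmul R N y) (LinearMap.range (LinearMap.lsmul R N y)).mkQ :=
  LinearMap.exact_map_mkQ_range _

/-- The quotient `N / yN`. -/
abbrev ModSmul (R : Type) [CommRing R] (y : R) (N : Type) [AddCommGroup N] [Module R N] : Type :=
  N ⧸ LinearMap.range (LinearMap.lsmul R N y)

lemma comp_mk0_lsmul_left {i : ℕ} (y : R)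
    (z : Abelian.Ext (ModuleCat.of R A) (ModuleCat.of R Y) i) :
    (Abelian.Ext.mk₀ (ModuleCat.ofHom (LinearMap.lsmul R A y))).comp z (zero_add i) = y • z := by
  have : ModuleCat.ofHom (LinearMap.lsmul R A y) = y • 𝟙 (ModuleCat.of R A) := by
    ext a; rfl
  rw [this, Abelian.Ext.mk₀_smul, Abelian.Ext.smul_comp, Abelian.Ext.mk₀_id_comp]

lemma extZero_of_surjective_smul [IsNoetherianRing R] [IsLocalRing R] [Module.Finite R A]
    [Module.Finite R Y] {i : ℕ} {y : R} (hy : y ∈ IsLocalRing.maximalIdeal R)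
    (h : ∀ z : Abelian.Ext (ModuleCat.of R A) (ModuleCat.of R Y) i, ∃ w, y • w = z) :
    ExtZero R i A Y := by
  let E := Abelian.Ext (ModuleCat.of R A) (ModuleCat.of R Y) i
  have : Module.Finite R E := ModuleCat.finite_ext R _ _ i
  have h1 : (⊤ : Submodule R E) = ⊥ := by
    refine Submodule.eq_bot_of_le_smul_of_le_jacobson_bot (IsLocalRing.maximalIdeal R) _
      Module.Finite.fg_top (fun z _ => ?_) (IsLocalRing.maximalIdeal_le_jacobson _)
    obtain ⟨w, rfl⟩ := h z
    exact Submodule.smul_mem_smul hy trivial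
  exact (Submodule.subsingleton_iff R).mp (subsingleton_of_bot_eq_top h1.symm)

/-- Nakayama: the vanishing of `Ext^{n+1}(N/yN, Y)` forces that of `Ext^n(N, Y)`. -/
lemma extZero_of_modSmul [IsNoetherianRing R] [IsLocalRing R] [Module.Finite R A]
    [Module.Finite R Y] {n : ℕ} {y : R} (hy : y ∈ IsLocalRing.maximalIdeal R)
    (hreg : IsSMulRegular A y) (h : ExtZero R (n + 1) (ModSmul R y A) Y) : ExtZero R n A Y := by
  refine extZero_of_surjective_smul hy fun z => ?_
  obtain ⟨w, hw⟩ := Abelian.Ext.contravariant_sequence_exact₁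
    (exactPair_shortExact (f := LinearMap.lsmul R A y) hreg (Submodule.mkQ_surjective _)
      (exact_smul_mkQ y A)) (ModuleCat.of R Y) z (add_comm 1 n) (h.eq_zero _)
  exact ⟨w, (comp_mk0_lsmul_left y w).symm.trans hw⟩

end ExtVanishing

section Comparison

variable {R : Type} [CommRing R]

lemma smul_extMk {N M : ModuleCat.{0} R} (P : ProjectiveResolution N) {n : ℕ} (r : R)
    (f : P.complex.X n ⟶ M) (hf : P.complex.d (n + 1) n ≫ f = 0) :
    P.extMk (r • f) (n + 1) rfl (by rw [Linear.comp_smul, hf, smul_zero]) =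
      r • P.extMk f (n + 1) rfl hf := by
  rw [Abelian.Ext.smul_eq_comp_mk₀, P.extMk_comp_mk₀]
  congr 1

/-- The map from cocycles of the Hom complex of a projective resolution to `Ext`. -/
def cocycleToExt {N : ModuleCat.{0} R} (P : ProjectiveResolution N) (M : ModuleCat.{0} R)
    (i n : ℕ) :
    LinearMap.ker ((P.complex.linearYonedaObj R M).sc' i n (n + 1)).g.hom →ₗ[R]
      Abelian.Ext N M n where
  toFun f := P.extMk (f.1 : P.complex.X n ⟶ M) (n + 1) rfl f.2
  map_add' f g := (P.add_extMk _ _ _ _ f.2 g.2).symm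
  map_smul' r f := smul_extMk P r _ f.2

lemma cocycleToExt_surjective {N : ModuleCat.{0} R} (P : ProjectiveResolution N)
    (M : ModuleCat.{0} R) (i n : ℕ) : Function.Surjective (cocycleToExt P M i n) := fun α => by
  obtain ⟨f, hf, rfl⟩ := P.extMk_surjective α (n + 1) rfl
  exact ⟨⟨f, hf⟩, rfl⟩

lemma ker_cocycleToExt {N : ModuleCat.{0} R} (P : ProjectiveResolution N)
    (M : ModuleCat.{0} R) (n : ℕ) :
    LinearMap.ker (cocycleToExt P M n (n + 1)) =
      LinearMap.range
        ((P.complex.linearYonedaObj R M).sc' n (n + 1) (n + 2)).moduleCatToCycles := by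
  ext f
  rw [LinearMap.mem_ker, LinearMap.mem_range]
  refine (P.extMk_eq_zero_iff (f.1 : P.complex.X (n + 1) ⟶ M) (n + 2) rfl f.2 n rfl).trans ?_
  exact ⟨fun ⟨g, hg⟩ => ⟨g, Subtype.ext hg⟩, fun ⟨g, hg⟩ => ⟨g, congrArg Subtype.val hg⟩⟩

/-- The module `Ext^{n+1}` defined through derived functors agrees with the one
defined in the derived category. -/
def modExtEquiv (n : ℕ) (N M : ModuleCat.{0} R) :
    ModExt R (n + 1) N M ≃ₗ[R] Abelian.Ext N M (n + 1) :=
  let P := projectiveResolution N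
  let K := P.complex.linearYonedaObj R M
  ((P.isoExt (n + 1) M).trans ((K.homologyIsoSc' n (n + 1) (n + 2) (by simp) (by simp)).trans
    (K.sc' n (n + 1) (n + 2)).moduleCatHomologyIso)).toLinearEquiv.trans
    ((Submodule.quotEquivOfEq _ _ (ker_cocycleToExt P M n).symm).trans
      ((cocycleToExt P M n (n + 1)).quotKerEquivOfSurjective
        (cocycleToExt_surjective P M n (n + 1))))

lemma subsingleton_modExt_zero_iff (N M : ModuleCat.{0} R) :
    Subsingleton (ModExt R 0 N M) ↔ Subsingleton (N ⟶ M) := by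
  let P := projectiveResolution N
  let K := P.complex.linearYonedaObj R M
  let S := K.sc' 0 0 1
  let e := ((P.isoExt 0 M).trans ((K.homologyIsoSc' 0 0 1 (by simp) (by simp)).trans
    S.moduleCatHomologyIso)).toLinearEquiv
  have hS : S.f = 0 := K.shape _ _ (by simp)
  rw [e.toEquiv.subsingleton_congr]
  change Subsingleton (LinearMap.ker S.g.hom ⧸ LinearMap.range S.moduleCatToCycles) ↔ _
  have hr : LinearMap.range S.moduleCatToCycles = ⊥ := by
    rw [LinearMap.range_eq_bot]
    exact LinearMap.ext fun a => Subtype.ext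
      (congrArg (fun u => u.hom a) hS)
  rw [hr, (Submodule.quotEquivOfEqBot _ rfl).toEquiv.subsingleton_congr]
  let p : P.complex.X 0 ⟶ N := P.π.f 0
  have hp : P.complex.d 1 0 ≫ p = 0 := P.complex_d_comp_π_f_zero
  have hepi : Epi p := inferInstanceAs (Epi (P.π.f 0))
  constructor
  · intro h
    refine ⟨fun a b => ?_⟩
    have key : ∀ c : N ⟶ M, P.complex.d 1 0 ≫ p ≫ c = 0 := fun c => by
      rw [← Category.assoc, hp, Limits.zero_comp]
    exact (cancel_epi p).mp (congrArg Subtype.val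
      (@Subsingleton.elim _ h ⟨p ≫ a, key a⟩ ⟨p ≫ b, key b⟩))
  · intro h
    have key : ∀ c : P.complex.X 0 ⟶ M, P.complex.d 1 0 ≫ c = 0 → c = 0 := fun c hc => by
      obtain ⟨c', rfl⟩ : ∃ c' : N ⟶ M, p ≫ c' = c :=
        ⟨P.exact₀.desc c hc, P.exact₀.g_desc c hc⟩
      rw [Subsingleton.elim c' 0, Limits.comp_zero]
    exact ⟨fun a b => Subtype.ext ((key _ a.2).trans (key _ b.2).symm)⟩

lemma subsingleton_modExt_iff (n : ℕ) (N M : ModuleCat.{0} R) :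
    Subsingleton (ModExt R n N M) ↔ Subsingleton (Abelian.Ext N M n) := by
  cases n with
  | zero =>
    rw [subsingleton_modExt_zero_iff, Abelian.Ext.addEquiv₀.subsingleton_congr]
  | succ n => exact (modExtEquiv n N M).toEquiv.subsingleton_congr

end Comparison

section LocalVanishing

variable {R : Type} [CommRing R]

lemma extZero_prod_left {i : ℕ} {A B Y : Type} [AddCommGroup A] [Module R A] [AddCommGroup B]
    [Module R B] [AddCommGroup Y] [Module R Y] (hA : ExtZero R i A Y) (hB : ExtZero R i B Y) :
    ExtZero R i (A × B) Y :=
  extZero_left_mid (f := LinearMap.inl R A B) (g := LinearMap.snd R A B)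
    LinearMap.inl_injective LinearMap.snd_surjective .inl_snd hA hB

lemma extZero_prod_right {i : ℕ} {A B Y : Type} [AddCommGroup A] [Module R A] [AddCommGroup B]
    [Module R B] [AddCommGroup Y] [Module R Y] (hA : ExtZero R i Y A) (hB : ExtZero R i Y B) :
    ExtZero R i Y (A × B) :=
  extZero_right_mid (f := LinearMap.inl R A B) (g := LinearMap.snd R A B)
    LinearMap.inl_injective LinearMap.snd_surjective .inl_snd hA hB

lemma extZero_pi_left {i : ℕ} {A Y : Type} [AddCommGroup A] [Module R A]
    [AddCommGroup Y] [Module R Y] (hA : ExtZero R i A Y) (n : ℕ) : ExtZero R i (Fin n → A) Y := by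
  induction n with
  | zero => exact extZero_of_subsingleton_left i
  | succ n ih =>
    exact extZero_of_linearEquiv_left (Fin.consLinearEquiv R fun _ => A) (extZero_prod_left hA ih)

lemma extZero_pi_right {i : ℕ} {A Y : Type} [AddCommGroup A] [Module R A]
    [AddCommGroup Y] [Module R Y] (hA : ExtZero R i Y A) (n : ℕ) : ExtZero R i Y (Fin n → A) := by
  induction n with
  | zero => exact extZero_of_subsingleton_right i
  | succ n ih =>
    exact extZero_of_linearEquiv_right (Fin.consLinearEquiv R fun _ => A) (extZero_prod_right hA ih)

/-- `Ext^i(-, Y)` vanishes on finitely generated modules for all `i > d`. -/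
def ExtBound (R : Type) [CommRing R] (d : ℕ) (Y : Type) [AddCommGroup Y] [Module R Y] : Prop :=
  ∀ (N : Type) [AddCommGroup N] [Module R N] [Module.Finite R N] (i : ℕ), d < i → ExtZero R i N Y

variable [IsLocalRing R]

/-- The first `r` modules `Ext^i(k, X)` vanish. -/
def DepthGE (R : Type) [CommRing R] [IsLocalRing R] (r : ℕ) (X : Type) [AddCommGroup X]
    [Module R X] : Prop :=
  ∀ i < r, ExtZero R i (IsLocalRing.ResidueField R) X

local notation "𝔪" => IsLocalRing.maximalIdeal R
local notation "𝕜" => IsLocalRing.ResidueField R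

lemma exists_equiv_pi_residueField {N : Type} [AddCommGroup N] [Module R N] [Module.Finite R N]
    (h : ∀ a ∈ 𝔪, ∀ x : N, a • x = 0) : ∃ n : ℕ, Nonempty (N ≃ₗ[R] (Fin n → 𝕜)) := by
  have ht : Module.IsTorsionBySet R N (𝔪 : Set R) := fun x a => h a a.2 x
  let : Module (R ⧸ 𝔪) N := ht.module
  let : Module 𝕜 N := inferInstanceAs (Module (R ⧸ 𝔪) N)
  have : IsScalarTower R 𝕜 N := inferInstanceAs (IsScalarTower R (R ⧸ 𝔪) N)
  have : Module.Finite 𝕜 N := Module.Finite.of_restrictScalars_finite R 𝕜 N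
  exact ⟨_, ⟨(Module.finBasis 𝕜 N).equivFun.restrictScalars R⟩⟩

variable [IsNoetherianRing R]

lemma extBound_of_residueField {d : ℕ} {Y : Type} [AddCommGroup Y] [Module R Y]
    [Module.Finite R Y] (hk : ∀ i, d < i → ExtZero R i 𝕜 Y) : ExtBound R d Y := by
  have key : ∀ I : Ideal R, ∀ (N : Type) [AddCommGroup N] [Module R N] [Module.Finite R N],
      (∀ a ∈ I, ∀ x : N, a • x = 0) → ∀ i, d < i → ExtZero R i N Y := by
    intro I
    induction I using IsNoetherian.induction with
    | hgt I ih =>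
    intro N _ _ _ hI i hi
    by_cases hm : 𝔪 ≤ I
    · obtain ⟨n, ⟨e⟩⟩ := exists_equiv_pi_residueField fun a ha => hI a (hm ha)
      exact extZero_of_linearEquiv_left e.symm (extZero_pi_left (hk i hi) n)
    · obtain ⟨a, ham, haI⟩ := SetLike.not_le_iff_exists.mp hm
      have hJ : I < I ⊔ Ideal.span {a} :=
        lt_of_le_of_ne le_sup_left fun h => haI (h ▸ le_sup_right (a := I)
          (Ideal.mem_span_singleton_self a))
      have hkill : ∀ (N' : Type) [AddCommGroup N'] [Module R N'], (∀ b ∈ I, ∀ x : N', b • x = 0) →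
          (∀ x : N', a • x = 0) → ∀ b ∈ I ⊔ Ideal.span {a}, ∀ x : N', b • x = 0 := by
        intro N' _ _ h1 h2 b hb x
        obtain ⟨c, hc, e, he, rfl⟩ := Submodule.mem_sup.mp hb
        obtain ⟨s, rfl⟩ := Ideal.mem_span_singleton'.mp he
        rw [add_smul, h1 c hc, mul_smul, h2, smul_zero, add_zero]
      let μ := LinearMap.lsmul R N a
      have hK : ExtZero R i (LinearMap.ker μ) Y := ih _ hJ _ (hkill _
        (fun b hb x => Subtype.ext (hI b hb x)) fun x => Subtype.ext x.2) i hi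
      have hQ : ExtZero R (i + 1) (ModSmul R a N) Y := by
        refine ih _ hJ _ (hkill _ (fun b hb x => ?_) fun x => ?_) _ (by omega)
        · obtain ⟨x, rfl⟩ := Submodule.mkQ_surjective _ x
          rw [← map_smul, hI b hb, map_zero]
        · obtain ⟨x, rfl⟩ := Submodule.mkQ_surjective _ x
          rw [← map_smul, Submodule.mkQ_apply, Submodule.Quotient.mk_eq_zero]
          exact ⟨x, rfl⟩
      refine extZero_of_surjective_smul ham fun z => ?_
      have e1 : Function.Exact (LinearMap.ker μ).subtype μ.rangeRestrict :=
        LinearMap.exact_iff.mpr (by rw [LinearMap.ker_rangeRestrict, Submodule.range_subtype])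
      obtain ⟨w, hw⟩ := Abelian.Ext.contravariant_sequence_exact₂
        (exactPair_shortExact (Submodule.subtype_injective _) μ.surjective_rangeRestrict e1)
        (ModuleCat.of R Y) z (hK.eq_zero _)
      have e2 : Function.Exact (LinearMap.range μ).subtype (LinearMap.range μ).mkQ :=
        LinearMap.exact_subtype_mkQ _
      obtain ⟨v, hv⟩ := Abelian.Ext.contravariant_sequence_exact₁
        (exactPair_shortExact (Submodule.subtype_injective _) (Submodule.mkQ_surjective _) e2)
        (ModuleCat.of R Y) w (add_comm 1 i) (hQ.eq_zero _)
      refine ⟨v, ?_⟩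
      rw [← hw, ← hv, Abelian.Ext.mk₀_comp_mk₀_assoc, ← comp_mk0_lsmul_left]
      rfl
  exact fun N _ _ _ i hi => key ⊥ N (by simp) i hi

end LocalVanishing

section HomExact

variable {R : Type} [CommRing R] {A B C Y : Type} [AddCommGroup A] [Module R A] [AddCommGroup B]
  [Module R B] [AddCommGroup C] [Module R C] [AddCommGroup Y] [Module R Y]
  {f : A →ₗ[R] B} {g : B →ₗ[R] C}

lemma lcomp_surjective_of_extZero (hf : Function.Injective f) (hg : Function.Surjective g)
    (h : Function.Exact f g) (hC : ExtZero R 1 C Y) : Function.Surjective (f.lcomp R Y) :=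
  fun u => exists_extend_of_extZero hf hg h hC u

lemma extZero_zero_of_injective_right {h : B →ₗ[R] C} (hh : Function.Injective h)
    (hC : ExtZero R 0 A C) : ExtZero R 0 A B := by
  rw [extZero_zero_iff] at hC ⊢
  refine ⟨fun u v => LinearMap.ext fun a => hh ?_⟩
  exact LinearMap.congr_fun (Subsingleton.elim (h ∘ₗ u) (h ∘ₗ v)) a

lemma extZero_modSmul_left {N Y : Type} [AddCommGroup N] [Module R N] [AddCommGroup Y]
    [Module R Y] {i : ℕ} {y : R} (hreg : IsSMulRegular N y) (h : ExtZero R i N Y)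
    (h' : ExtZero R (i + 1) N Y) : ExtZero R (i + 1) (ModSmul R y N) Y :=
  extZero_left_snd (f := LinearMap.lsmul R N y) hreg (Submodule.mkQ_surjective _)
    (exact_smul_mkQ y N) h' h

lemma extZero_hom_free {n i : ℕ} {A Y : Type} [AddCommGroup A] [Module R A] [AddCommGroup Y]
    [Module R Y] (h : ExtZero R i A Y) : ExtZero R i A ((Fin n → R) →ₗ[R] Y) :=
  extZero_of_linearEquiv_right (Module.piEquiv (Fin n) R Y) (extZero_pi_right h n)

lemma extZero_ker_of_surjective {n i : ℕ} {N Y : Type} [AddCommGroup N] [Module R N]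
    [AddCommGroup Y] [Module R Y] {f : (Fin n → R) →ₗ[R] N} (hf : Function.Surjective f)
    (h : ExtZero R (i + 2) N Y) : ExtZero R (i + 1) (LinearMap.ker f) Y :=
  extZero_left_fst (Submodule.subtype_injective _) hf (LinearMap.exact_subtype_ker_map f)
    (extZero_succ_of_projective i) h

end HomExact

section LocalDepth

variable {R : Type} [CommRing R] [IsLocalRing R]

local notation "𝔪" => IsLocalRing.maximalIdeal R
local notation "𝕜" => IsLocalRing.ResidueField R

instance isSimpleModule_residueField : IsSimpleModule R 𝕜 :=
  isSimpleModule_iff_isCoatom.mpr (Ideal.isMaximal_def.mp inferInstance)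

lemma smul_residueField_eq_zero {y : R} (hy : y ∈ 𝔪) (z : 𝕜) : y • z = 0 := by
  rw [Algebra.smul_def, IsLocalRing.ResidueField.algebraMap_eq,
    (IsLocalRing.residue_eq_zero_iff y).mpr hy, zero_mul]

lemma depthGE_modSmul {N : Type} [AddCommGroup N] [Module R N] {r : ℕ} {y : R}
    (hreg : IsSMulRegular N y) (h : DepthGE R (r + 1) N) : DepthGE R r (ModSmul R y N) :=
  fun i hi => extZero_right_snd (f := LinearMap.lsmul R N y) hreg (Submodule.mkQ_surjective _)
    (exact_smul_mkQ y N) (h i (by omega)) (h (i + 1) (by omega))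

lemma extZero_residueField_of_modSmul {N : Type} [AddCommGroup N] [Module R N] {r : ℕ} {y : R}
    (hy : y ∈ 𝔪) (hreg : IsSMulRegular N y) (h : ExtZero R r 𝕜 (ModSmul R y N)) :
    ExtZero R (r + 1) 𝕜 N := by
  refine .of_forall fun z => ?_
  have hz : y • z = 0 := by
    have h0 : ModuleCat.ofHom (LinearMap.lsmul R 𝕜 y) = 0 :=
      ModuleCat.hom_ext (LinearMap.ext fun a => smul_residueField_eq_zero hy a)
    rw [← comp_mk0_lsmul_left, h0, Abelian.Ext.mk₀_zero, Abelian.Ext.zero_comp]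
  have hl : ModuleCat.ofHom (LinearMap.lsmul R N y) = y • 𝟙 (ModuleCat.of R N) := rfl
  rw [Abelian.Ext.smul_eq_comp_mk₀, ← hl] at hz
  obtain ⟨w, hw⟩ := Abelian.Ext.covariant_sequence_exact₁ (ModuleCat.of R 𝕜)
    (exactPair_shortExact (f := LinearMap.lsmul R N y) hreg (Submodule.mkQ_surjective _)
      (exact_smul_mkQ y N)) z hz rfl
  rw [← hw, h.eq_zero w, Abelian.Ext.zero_comp]

variable [IsNoetherianRing R]

lemma exists_regular_of_extZero {N : Type} [AddCommGroup N] [Module R N] [Module.Finite R N]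
    (h : ExtZero R 0 𝕜 N) : ∃ y ∈ 𝔪, IsSMulRegular N y := by
  obtain ⟨y, hy, hreg⟩ := IsSMulRegular.subsingleton_linearMap_iff.mp (extZero_zero_iff.mp h)
  refine ⟨y, ?_, hreg⟩
  rw [← IsLocalRing.residue_eq_zero_iff]
  have := Module.mem_annihilator.mp hy (1 : 𝕜)
  rwa [Algebra.smul_def, mul_one] at this

lemma exists_depth_zero_module {Y : Type} [AddCommGroup Y] [Module R Y] (r : ℕ) :
    ∀ (j : ℕ) (N : Type) [AddCommGroup N] [Module R N] [Module.Finite R N],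
      (∀ i, j < i → ExtZero R i N Y) → DepthGE R r N → ¬ ExtZero R r 𝕜 N →
      ∃ (N' : ModuleCat.{0} R), Module.Finite R N' ∧ (∀ i, r + j < i → ExtZero R i N' Y) ∧
        ¬ ExtZero R 0 𝕜 N' := by
  induction r with
  | zero =>
    intro j N _ _ _ h1 _ h3
    exact ⟨ModuleCat.of R N, ‹_›, fun i hi => h1 i (by omega), h3⟩
  | succ r ih =>
    intro j N _ _ _ h1 h2 h3
    obtain ⟨y, hy, hreg⟩ := exists_regular_of_extZero (h2 0 (by omega))
    obtain ⟨N', hfin, h4, h5⟩ := ih (j + 1) (ModSmul R y N) (fun i hi => by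
      obtain ⟨i, rfl⟩ := Nat.exists_eq_succ_of_ne_zero (show i ≠ 0 by omega)
      exact extZero_modSmul_left hreg (h1 i (by omega)) (h1 _ (by omega)))
      (depthGE_modSmul hreg h2) (fun h => h3 (extZero_residueField_of_modSmul hy hreg h))
    exact ⟨N', hfin, fun i hi => h4 i (by omega), h5⟩

/-- A finitely generated module of finite injective dimension has injective dimension at most
the depth of the ring. -/
lemma extBound_depth {Y : Type} [AddCommGroup Y] [Module R Y] [Module.Finite R Y] {d : ℕ}
    (hR : DepthGE R d R) (hR' : ¬ ExtZero R d 𝕜 R) {n : ℕ} (hY : ExtBound R n Y) :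
    ExtBound R d Y := by
  obtain ⟨N, hfin, h1, h2⟩ := exists_depth_zero_module (Y := Y) d 0 R (fun i hi => by
    obtain ⟨i, rfl⟩ := Nat.exists_eq_succ_of_ne_zero (show i ≠ 0 by omega)
    exact extZero_succ_of_projective i) hR hR'
  rw [extZero_zero_iff, not_subsingleton_iff_nontrivial] at h2
  obtain ⟨φ, hφ⟩ := exists_ne (0 : 𝕜 →ₗ[R] N)
  have hinj : Function.Injective φ := LinearMap.injective_of_ne_zero hφ
  have key : ∀ t : ℕ, ExtBound R (d + t) Y → ExtBound R d Y := by
    intro t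
    induction t with
    | zero => exact id
    | succ t ih =>
      intro h
      refine ih (extBound_of_residueField fun i hi => ?_)
      exact extZero_left_fst hinj (Submodule.mkQ_surjective _) (LinearMap.exact_map_mkQ_range φ)
        (h1 i (by omega)) (h _ (i + 1) (by omega))
  exact key n fun N _ _ _ i hi => hY N i (by omega)

lemma extZero_of_depthGE {Y : Type} [AddCommGroup Y] [Module R Y] [Module.Finite R Y] {d : ℕ}
    (hY : ExtBound R d Y) (r : ℕ) : ∀ (X : Type) [AddCommGroup X] [Module R X] [Module.Finite R X],
      DepthGE R r X → ∀ i, d < i + r → ExtZero R i X Y := by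
  induction r with
  | zero => exact fun X _ _ _ _ i hi => hY X i hi
  | succ r ih =>
    intro X _ _ _ hX i hi
    obtain ⟨y, hy, hreg⟩ := exists_regular_of_extZero (hX 0 (by omega))
    exact extZero_of_modSmul hy hreg (ih _ (depthGE_modSmul hreg hX) (i + 1) (by omega))

lemma depthGE_hom {W : Type} [AddCommGroup W] [Module R W] {d : ℕ} (hW : DepthGE R d W)
    (N : Type) [AddCommGroup N] [Module R N] [Module.Finite R N]
    (hN : ∀ i, ExtZero R (i + 1) N W) : DepthGE R d (N →ₗ[R] W) := by
  intro i
  induction i generalizing N with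
  | zero =>
    intro hi
    obtain ⟨n, f, hf⟩ := Module.Finite.exists_fin' R N
    exact extZero_zero_of_injective_right (LinearMap.lcomp_injective_of_surjective f hf)
      (extZero_hom_free (n := n) (hW 0 hi))
  | succ i ih =>
    intro hi
    obtain ⟨n, f, hf⟩ := Module.Finite.exists_fin' R N
    exact extZero_right_fst (LinearMap.lcomp_injective_of_surjective f hf)
      (lcomp_surjective_of_extZero (Submodule.subtype_injective _) hf
        (LinearMap.exact_subtype_ker_map f) (hN 0))
      (LinearMap.exact_lcomp_of_exact_of_surjective _ (LinearMap.exact_subtype_ker_map f) hf)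
      (extZero_hom_free (n := n) (hW (i + 1) hi))
      (ih _ (fun j => extZero_ker_of_surjective hf (hN (j + 1))) (by omega))

/-- A finitely generated module with no `Ext` into the canonical module is zero. -/
lemma subsingleton_of_forall_extZero {W : Type} [AddCommGroup W] [Module R W] [Module.Finite R W]
    {d : ℕ} (hW : ExtBound R d W) (hWd : ¬ ExtZero R d 𝕜 W) {C : Type} [AddCommGroup C]
    [Module R C] [Module.Finite R C] (hC : ∀ i, ExtZero R i C W) : Subsingleton C := by
  have key : ∀ I : Ideal R, ∀ (C : Type) [AddCommGroup C] [Module R C] [Module.Finite R C],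
      Module.annihilator R C = I → (∀ i, ExtZero R i C W) → Subsingleton C := by
    intro I
    induction I using IsNoetherian.induction with
    | hgt I ih =>
    intro C _ _ _ hI h
    by_contra hne
    by_cases h0 : ExtZero R 0 𝕜 C
    · obtain ⟨y, hy, hreg⟩ := exists_regular_of_extZero h0
      have hsub : Subsingleton (ModSmul R y C) := by
        refine ih (Module.annihilator R (ModSmul R y C)) ?_ _ rfl fun i => ?_
        · refine lt_of_le_of_ne ?_ fun he => ?_
          · rw [← hI]
            exact LinearMap.annihilator_le_of_surjective
              (Submodule.mkQ (LinearMap.range (LinearMap.lsmul R C y))) (Submodule.mkQ_surjective _)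
          · have hyI : y ∈ I := by
              rw [he, Module.mem_annihilator]
              intro c
              obtain ⟨c, rfl⟩ := Submodule.mkQ_surjective _ c
              rw [← map_smul, Submodule.mkQ_apply, Submodule.Quotient.mk_eq_zero]
              exact ⟨c, rfl⟩
            rw [← hI, Module.mem_annihilator] at hyI
            exact hne ⟨fun a b => hreg ((hyI a).trans (hyI b).symm)⟩
        · cases i with
          | zero =>
            have := extZero_zero_iff.mp (h 0)
            refine extZero_zero_iff.mpr ⟨fun u v => ?_⟩
            exact LinearMap.cancel_right (Submodule.mkQ_surjective _) |>.mp
              (Subsingleton.elim _ _)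
          | succ i => exact extZero_modSmul_left hreg (h i) (h (i + 1))
      have htop : LinearMap.range (LinearMap.lsmul R C y) = ⊤ :=
        Submodule.Quotient.subsingleton_iff.mp hsub
      have hbot : (⊤ : Submodule R C) = ⊥ := by
        refine Submodule.eq_bot_of_le_smul_of_le_jacobson_bot 𝔪 _ Module.Finite.fg_top
          (fun z _ => ?_) (IsLocalRing.maximalIdeal_le_jacobson _)
        obtain ⟨w, rfl⟩ := htop.symm ▸ (Submodule.mem_top : z ∈ ⊤)
        exact Submodule.smul_mem_smul hy trivial
      exact hne ((Submodule.subsingleton_iff R).mp (subsingleton_of_bot_eq_top hbot.symm))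
    · rw [extZero_zero_iff, not_subsingleton_iff_nontrivial] at h0
      obtain ⟨φ, hφ⟩ := exists_ne (0 : 𝕜 →ₗ[R] C)
      exact hWd (extZero_left_fst (LinearMap.injective_of_ne_zero hφ)
        (Submodule.mkQ_surjective _) (LinearMap.exact_map_mkQ_range φ) (h d)
        (hW _ (d + 1) (by omega)))
  exact key _ C rfl hC

end LocalDepth

section CanonicalIdeal

variable {R : Type} [CommRing R] [IsLocalRing R] [IsNoetherianRing R]

local notation "𝕜" => IsLocalRing.ResidueField R

lemma extZero_self_of_depthGE {W : Type} [AddCommGroup W] [Module R W] [Module.Finite R W] {d : ℕ}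
    (hW : ExtBound R d W) (hWd : DepthGE R d W) (i : ℕ) : ExtZero R (i + 1) W W :=
  extZero_of_depthGE hW d W hWd (i + 1) (by omega)

/-- Every endomorphism of a canonical ideal is multiplication by a ring element. -/
lemma exists_smul_eq_of_end {ω : Ideal R} {x : R} (hxω : x ∈ ω) (hx : x ∈ nonZeroDivisors R)
    {d : ℕ} (hW : ExtBound R d ω) (hWd : DepthGE R d ω) (hWd' : ¬ ExtZero R d 𝕜 ω)
    (φ : ω →ₗ[R] ω) : ∃ r : R, ∀ w, φ w = r • w := by
  let f : R →ₗ[R] (ω →ₗ[R] ω) := LinearMap.toSpanSingleton R _ LinearMap.id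
  have hf : Function.Injective f := by
    rw [← LinearMap.ker_eq_bot, LinearMap.ker_eq_bot']
    intro r hr
    have h1 : r * x = 0 := congrArg Subtype.val (LinearMap.congr_fun hr ⟨x, hxω⟩)
    exact (mem_nonZeroDivisors_iff.mp hx).2 r h1
  have hE : ∀ i, ExtZero R (i + 1) (ω →ₗ[R] ω) ω := fun i =>
    extZero_of_depthGE hW d _ (depthGE_hom hWd ω (extZero_self_of_depthGE hW hWd)) _ (by omega)
  have hsurj := Submodule.mkQ_surjective (LinearMap.range f)
  have hex := LinearMap.exact_map_mkQ_range f
  have hC : ∀ i, ExtZero R i ((ω →ₗ[R] ω) ⧸ LinearMap.range f) ω := by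
    intro i
    match i with
    | 0 =>
      rw [extZero_zero_iff]
      have key : ∀ u : ((ω →ₗ[R] ω) ⧸ LinearMap.range f) →ₗ[R] ω, u = 0 := by
        refine fun u => LinearMap.ext fun c => ?_
        obtain ⟨e, rfl⟩ := hsurj c
        have h1 : x • (LinearMap.range f).mkQ e = 0 := by
          rw [← map_smul, Submodule.mkQ_apply, Submodule.Quotient.mk_eq_zero]
          refine ⟨(e ⟨x, hxω⟩ : R), LinearMap.ext fun w => ?_⟩
          change ((e ⟨x, hxω⟩ : ω) : R) • w = x • e w
          have h2 : x • w = (w : R) • (⟨x, hxω⟩ : ω) := Subtype.ext (mul_comm x (w : R))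
          rw [← map_smul, h2, map_smul]
          exact Subtype.ext (mul_comm _ _)
        have h3 : x • u ((LinearMap.range f).mkQ e) = 0 := by rw [← map_smul, h1, map_zero]
        exact Subtype.ext ((mem_nonZeroDivisors_iff.mp hx).1 _ (congrArg Subtype.val h3))
      exact ⟨fun u v => (key u).trans (key v).symm⟩
    | 1 =>
      refine extZero_one_of_forall_extend hf hsurj hex (hE 0) fun u => ?_
      refine ⟨LinearMap.applyₗ (u 1), LinearMap.ext fun r => ?_⟩
      change r • u 1 = u r
      rw [← map_smul, smul_eq_mul, mul_one]
    | i + 2 => exact extZero_left_snd hf hsurj hex (hE (i + 1)) (extZero_succ_of_projective i)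
  have hsub := subsingleton_of_forall_extZero hW hWd' hC
  rw [Submodule.Quotient.subsingleton_iff] at hsub
  obtain ⟨r, hr⟩ : φ ∈ LinearMap.range f := hsub ▸ Submodule.mem_top
  exact ⟨r, fun w => (LinearMap.congr_fun hr w).symm⟩

end CanonicalIdeal

section MinimalHull

variable {R : Type} [CommRing R]

/-- Uniqueness of the cokernel in a minimal hull: a hull that is left minimal is isomorphic to
one without common summands. -/
lemma nonempty_equiv_of_minimal {M Y₀ X₀ : Type} [AddCommGroup M] [Module R M] [AddCommGroup Y₀]
    [Module R Y₀] [AddCommGroup X₀] [Module R X₀] {Y X : ModuleCat.{0} R}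
    {ι₀ : M →ₗ[R] Y₀} {π₀ : Y₀ →ₗ[R] X₀} (hι₀ : Function.Injective ι₀)
    (hπ₀ : Function.Surjective π₀) (h₀ : Function.Exact ι₀ π₀)
    {ι : M →ₗ[R] Y} {π : Y →ₗ[R] X} (hι : Function.Injective ι)
    (hπ : Function.Surjective π) (h : Function.Exact ι π)
    (hX₀ : ExtZero R 1 X₀ Y) (hX : ExtZero R 1 X Y₀)
    (hmin₀ : ∀ φ : Y₀ →ₗ[R] Y₀, φ ∘ₗ ι₀ = ι₀ → Function.Bijective φ)
    (hmin : ¬ HasCommonSummandVia R π) : Nonempty (X ≃ₗ[R] X₀) := by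
  obtain ⟨f, hf⟩ := exists_extend_of_extZero hι₀ hπ₀ h₀ hX₀ ι
  obtain ⟨g, hg⟩ := exists_extend_of_extZero hι hπ h hX ι₀
  have hgf : (g ∘ₗ f) ∘ₗ ι₀ = ι₀ := by rw [LinearMap.comp_assoc, hf, hg]
  let e₀ := LinearEquiv.ofBijective (g ∘ₗ f) (hmin₀ _ hgf)
  let s : Y₀ →ₗ[R] Y := f ∘ₗ e₀.symm.toLinearMap
  have hgs : ∀ z, g (s z) = z := fun z => e₀.apply_symm_apply z
  have hsι : ∀ m, s (ι₀ m) = ι m := fun m => by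
    have h1 : e₀.symm (ι₀ m) = ι₀ m :=
      e₀.symm_apply_eq.mpr (LinearMap.congr_fun hgf m).symm
    change f (e₀.symm (ι₀ m)) = ι m
    rw [h1]
    exact LinearMap.congr_fun hf m
  let N := LinearMap.ker g
  let p : Y →ₗ[R] N := (LinearMap.id - s ∘ₗ g).codRestrict N fun y => by
    simp [N, hgs]
  have hp : ∀ y, ((p y : N) : Y) = y - s (g y) := fun y => rfl
  have hpN : ∀ n : N, p n = n := fun n => Subtype.ext (by
    rw [hp, LinearMap.mem_ker.mp n.2, map_zero, sub_zero])
  have hps : ∀ z, p (s z) = 0 := fun z => Subtype.ext (by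
    rw [hp, hgs, sub_self]; rfl)
  have hgN : ∀ n : N, g n = 0 := fun n => n.2
  let e : Y ≃ₗ[R] N × Y₀ :=
    { p.prod g with
      invFun := fun z => z.1 + s z.2
      left_inv := fun y => by
        change ((p y : N) : Y) + s (g y) = y
        rw [hp, sub_add_cancel]
      right_inv := fun z => by
        change (p (z.1 + s z.2), g (z.1 + s z.2)) = z
        rw [map_add, map_add, hpN, hps, hgN, hgs, add_zero, zero_add] }
  let T : Y →ₗ[R] N × X₀ := p.prod (π₀ ∘ₗ g)
  have hT : Function.Surjective T := by
    rintro ⟨n, c⟩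
    obtain ⟨z, rfl⟩ := hπ₀ c
    refine ⟨n + s z, ?_⟩
    change (p (n + s z), π₀ (g (n + s z))) = _
    rw [map_add, map_add, hpN, hps, hgN, hgs, add_zero, zero_add]
  have hker : LinearMap.ker π = LinearMap.ker T := by
    ext y
    rw [LinearMap.mem_ker, LinearMap.mem_ker, h y]
    constructor
    · rintro ⟨m, rfl⟩
      have h1 : g (ι m) = ι₀ m := LinearMap.congr_fun hg m
      change (p (ι m), π₀ (g (ι m))) = 0
      rw [h1, h₀.apply_apply_eq_zero, ← hsι, hps]
      rfl
    · intro hy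
      have h1 : p y = 0 := congrArg Prod.fst hy
      obtain ⟨m, hm⟩ := (h₀ (g y)).mp (congrArg Prod.snd hy)
      refine ⟨m, ?_⟩
      have h2 := hp y
      rw [h1, ← hm, hsι] at h2
      exact (sub_eq_zero.mp h2.symm).symm
  let F : X ≃ₗ[R] N × X₀ := (π.quotKerEquivOfSurjective hπ).symm.trans
    ((Submodule.quotEquivOfEq _ _ hker).trans (T.quotKerEquivOfSurjective hT))
  have hF : ∀ y, F (π y) = T y := fun y => by
    have h1 : (π.quotKerEquivOfSurjective hπ).symm (π y) = (LinearMap.ker π).mkQ y :=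
      (LinearEquiv.symm_apply_eq _).mpr rfl
    change (T.quotKerEquivOfSurjective hT) (Submodule.quotEquivOfEq _ _ hker
      ((π.quotKerEquivOfSurjective hπ).symm (π y))) = T y
    rw [h1]
    rfl
  have hN : Subsingleton N := by
    by_contra hN
    rw [not_subsingleton_iff_nontrivial] at hN
    exact hmin ⟨ModuleCat.of R N, ModuleCat.of R Y₀, ModuleCat.of R X₀, hN, e, F, π₀, hF⟩
  let : Unique N := Unique.mk' N
  exact ⟨F.trans LinearEquiv.uniqueProd⟩

end MinimalHull

section Resolution

variable {R : Type} [CommRing R]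

lemma exists_injective_of_ker_eq {H M Y : Type} [AddCommGroup H] [Module R H] [AddCommGroup M]
    [Module R M] [AddCommGroup Y] [Module R Y] {δ : H →ₗ[R] M} {j : H →ₗ[R] Y}
    (hδ : Function.Surjective δ) (hker : LinearMap.ker δ = LinearMap.ker j) :
    ∃ ι : M →ₗ[R] Y, Function.Injective ι ∧ ι ∘ₗ δ = j := by
  let e := (δ.quotKerEquivOfSurjective hδ).symm.trans
    ((Submodule.quotEquivOfEq _ _ hker).trans j.quotKerEquivRange)
  refine ⟨(LinearMap.range j).subtype ∘ₗ e.toLinearMap,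
    (Submodule.subtype_injective _).comp e.injective, LinearMap.ext fun h => ?_⟩
  have h1 : (δ.quotKerEquivOfSurjective hδ).symm (δ h) = (LinearMap.ker δ).mkQ h :=
    (LinearEquiv.symm_apply_eq _).mpr rfl
  change ((j.quotKerEquivRange (Submodule.quotEquivOfEq _ _ hker
    ((δ.quotKerEquivOfSurjective hδ).symm (δ h))) : LinearMap.range j) : Y) = j h
  rw [h1]
  rfl

/-- The connecting map `Hom(K, W) → Ext¹(V, W)` of a short exact sequence. -/
def connecting {K F V : Type} [AddCommGroup K] [Module R K] [AddCommGroup F] [Module R F]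
    [AddCommGroup V] [Module R V] {f : K →ₗ[R] F} {g : F →ₗ[R] V} (hf : Function.Injective f)
    (hg : Function.Surjective g) (h : Function.Exact f g) (W : Type) [AddCommGroup W]
    [Module R W] : (K →ₗ[R] W) →ₗ[R]
      Abelian.Ext (ModuleCat.of R V) (ModuleCat.of R W) 1 where
  toFun u := (exactPair_shortExact hf hg h).extClass.comp
    (Abelian.Ext.mk₀ (ModuleCat.ofHom u)) (add_zero 1)
  map_add' u v := by
    rw [← Abelian.Ext.comp_add, ← Abelian.Ext.mk₀_add]
    rfl
  map_smul' r u := by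
    rw [RingHom.id_apply, ← Abelian.Ext.comp_smul, ← Abelian.Ext.mk₀_smul]
    rfl

section

variable {K F V : Type} [AddCommGroup K] [Module R K] [AddCommGroup F] [Module R F]
  [AddCommGroup V] [Module R V] {f : K →ₗ[R] F} {g : F →ₗ[R] V} (hf : Function.Injective f)
  (hg : Function.Surjective g) (h : Function.Exact f g) {W : Type} [AddCommGroup W] [Module R W]

lemma connecting_surjective (hF : ExtZero R 1 F W) :
    Function.Surjective (connecting hf hg h W) := by
  intro z
  obtain ⟨w, hw⟩ := Abelian.Ext.contravariant_sequence_exact₃ (exactPair_shortExact hf hg h)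
    (ModuleCat.of R W) z (hF.eq_zero _) (add_zero 1)
  obtain ⟨u, rfl⟩ := Abelian.Ext.addEquiv₀.symm.surjective w
  exact ⟨u.hom, hw⟩

lemma ker_connecting : LinearMap.ker (connecting hf hg h W) = LinearMap.range (f.lcomp R W) := by
  ext u
  constructor
  · intro hu
    obtain ⟨w, hw⟩ := Abelian.Ext.contravariant_sequence_exact₁ (exactPair_shortExact hf hg h)
      (ModuleCat.of R W) (Abelian.Ext.mk₀ (ModuleCat.ofHom u)) (add_zero 1) hu
    obtain ⟨v, rfl⟩ := Abelian.Ext.addEquiv₀.symm.surjective w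
    change (Abelian.Ext.mk₀ _).comp (Abelian.Ext.mk₀ v) _ = _ at hw
    rw [Abelian.Ext.mk₀_comp_mk₀] at hw
    exact ⟨v.hom, congrArg ModuleCat.Hom.hom (Abelian.Ext.addEquiv₀.symm.injective hw)⟩
  · rintro ⟨v, rfl⟩
    have h3 : Abelian.Ext.mk₀ (ModuleCat.ofHom (v ∘ₗ f)) =
        (Abelian.Ext.mk₀ (exactPair f g h).f).comp
          (Abelian.Ext.mk₀ (ModuleCat.ofHom v)) (zero_add 0) := by
      rw [Abelian.Ext.mk₀_comp_mk₀]; rfl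
    change (exactPair_shortExact hf hg h).extClass.comp
      (Abelian.Ext.mk₀ (ModuleCat.ofHom (v ∘ₗ f))) (add_zero 1) = 0
    rw [h3, ShortComplex.ShortExact.extClass_comp_assoc]

end

/-- The map `R^n → W` sending the `i`-th basis vector to `w` and the others to zero. -/
def coordMap {n : ℕ} {W : Type} [AddCommGroup W] [Module R W] (i : Fin n) :
    W →ₗ[R] ((Fin n → R) →ₗ[R] W) where
  toFun w := (LinearMap.toSpanSingleton R W w) ∘ₗ LinearMap.proj i
  map_add' v w := LinearMap.ext fun s => smul_add (s i) v w
  map_smul' r w := LinearMap.ext fun s => smul_comm (s i) r w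

lemma coordMap_apply {n : ℕ} {W : Type} [AddCommGroup W] [Module R W] (i : Fin n) (w : W)
    (s : Fin n → R) : coordMap i w s = s i • w := rfl

lemma eq_sum_coordMap {n : ℕ} {W : Type} [AddCommGroup W] [Module R W]
    (u : (Fin n → R) →ₗ[R] W) : u = ∑ i, coordMap i (u (Pi.single i 1)) := by
  refine LinearMap.ext fun s => ?_
  rw [LinearMap.sum_apply]
  conv_lhs => rw [pi_eq_sum_univ' s, map_sum]
  refine Finset.sum_congr rfl fun i _ => ?_
  rw [map_smul, coordMap_apply]

end Resolution

section Core

variable {R : Type} [CommRing R] [IsLocalRing R]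

local notation "𝔪" => IsLocalRing.maximalIdeal R

/-- An endomorphism of `Hom(P, W)` killing all maps that factor through `∂` has its image in
the maximal ideal times `Hom(P, W)`, when the kernel of `∂` has coordinates in the maximal ideal. -/
lemma apply_mem_smul_top {ω : Ideal R} {x : R} (hxω : x ∈ ω) (hx : x ∈ nonZeroDivisors R)
    (hend : ∀ φ : ω →ₗ[R] ω, ∃ r : R, ∀ w, φ w = r • w) {a b : ℕ}
    {D : (Fin b → R) →ₗ[R] (Fin a → R)} (hD : ∀ z, D z = 0 → ∀ i, z i ∈ 𝔪)
    (G : ((Fin b → R) →ₗ[R] ω) →ₗ[R] ((Fin b → R) →ₗ[R] ω))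
    (hG : ∀ u : (Fin a → R) →ₗ[R] ω, G (u ∘ₗ D) = 0) (u : (Fin b → R) →ₗ[R] ω) :
    G u ∈ 𝔪 • (⊤ : Submodule R ((Fin b → R) →ₗ[R] ω)) := by
  choose r hr using fun i l : Fin b =>
    hend ((LinearMap.applyₗ (Pi.single i 1 : Fin b → R)) ∘ₗ G ∘ₗ coordMap l)
  have hη : ∀ (i : Fin b) (v : (Fin b → R) →ₗ[R] ω), G v (Pi.single i 1) = v (r i) := by
    intro i v
    have h1 : ∀ l w, G (coordMap l w) (Pi.single i 1) = r i l • w := fun l w => hr i l w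
    conv_lhs => rw [eq_sum_coordMap v, map_sum, LinearMap.sum_apply]
    conv_rhs => rw [eq_sum_coordMap v, LinearMap.sum_apply]
    exact Finset.sum_congr rfl fun l _ => h1 l _
  have hrm : ∀ i l, r i l ∈ 𝔪 := by
    refine fun i => hD _ (funext fun j => ?_)
    have h1 := hη i (coordMap j (⟨x, hxω⟩ : ω) ∘ₗ D)
    rw [hG, LinearMap.zero_apply, LinearMap.comp_apply, coordMap_apply] at h1
    exact (mem_nonZeroDivisors_iff.mp hx).2 _ (congrArg Subtype.val h1.symm)
  rw [eq_sum_coordMap (G u)]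
  refine Submodule.sum_mem _ fun i _ => ?_
  rw [hη, eq_sum_coordMap u, LinearMap.sum_apply, map_sum]
  refine Submodule.sum_mem _ fun l _ => ?_
  rw [coordMap_apply, map_smul]
  exact Submodule.smul_mem_smul (hrm i l) trivial

lemma bijective_of_sub_mem {Y : Type} [AddCommGroup Y] [Module R Y] [Module.Finite R Y]
    {φ : Y →ₗ[R] Y} (h : ∀ y, φ y - y ∈ 𝔪 • (⊤ : Submodule R Y)) : Function.Bijective φ := by
  refine OrzechProperty.bijective_of_surjective_endomorphism φ (LinearMap.range_eq_top.mp ?_)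
  refine top_le_iff.mp (Submodule.le_of_le_smul_of_le_jacobson_bot Module.Finite.fg_top
    (IsLocalRing.maximalIdeal_le_jacobson _) fun y _ => ?_)
  rw [← sub_sub_cancel (φ y) y]
  exact Submodule.sub_mem _ (Submodule.mem_sup_left ⟨y, rfl⟩) (Submodule.mem_sup_right (h y))

variable [IsNoetherianRing R]

/-- The cokernel of a minimal hull of `Ext¹(V, ω)`, computed from a presentation of `V` which is
minimal at the second step. -/
lemma nonempty_equiv_hom_ker {ω : Ideal R} {x : R} (hxω : x ∈ ω) (hx : x ∈ nonZeroDivisors R)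
    (hend : ∀ φ : ω →ₗ[R] ω, ∃ r : R, ∀ w, φ w = r • w) {d : ℕ} (hW : ExtBound R d ω)
    (hWd : DepthGE R d ω) {V : Type} [AddCommGroup V] [Module R V] (hV0 : ExtZero R 0 V ω)
    (hV : ∀ i, ExtZero R (i + 2) V ω) {a b : ℕ} {D : (Fin b → R) →ₗ[R] (Fin a → R)}
    {ρ : (Fin a → R) →ₗ[R] V} (hρ : Function.Surjective ρ) (hDρ : Function.Exact D ρ)
    (hD : ∀ z, D z = 0 → ∀ i, z i ∈ 𝔪)
    {M : Type} [AddCommGroup M] [Module R M]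
    (eM : M ≃ₗ[R] Abelian.Ext (ModuleCat.of R V) (ModuleCat.of R ω) 1)
    {Y X : ModuleCat.{0} R} {ι : M →ₗ[R] Y} {π : Y →ₗ[R] X} (hι : Function.Injective ι)
    (hπ : Function.Surjective π) (hex : Function.Exact ι π) (hmin : ¬ HasCommonSummandVia R π)
    [Module.Finite R Y] [Module.Finite R X] (hY : ExtBound R d Y) (hX : DepthGE R d X) :
    Nonempty (X ≃ₗ[R] (LinearMap.ker D →ₗ[R] ω)) := by
  let K := LinearMap.ker ρ
  let D' : (Fin b → R) →ₗ[R] K := D.codRestrict K fun z => hDρ.apply_apply_eq_zero z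
  have hD' : Function.Surjective D' := fun k => by
    obtain ⟨z, hz⟩ := (hDρ k).mp k.2
    exact ⟨z, Subtype.ext hz⟩
  have hkerD' : LinearMap.ker D' = LinearMap.ker D := LinearMap.ker_codRestrict _ _ _
  have hexD' : Function.Exact (LinearMap.ker D).subtype D' :=
    LinearMap.exact_iff.mpr (by rw [hkerD', Submodule.range_subtype])
  let c : ((Fin a → R) →ₗ[R] ω) →ₗ[R] ((Fin b → R) →ₗ[R] ω) := D.lcomp R ω
  let rs : ((Fin b → R) →ₗ[R] ω) →ₗ[R] (LinearMap.ker D →ₗ[R] ω) :=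
    (LinearMap.ker D).subtype.lcomp R ω
  have hc : Function.Injective c := by
    rw [← LinearMap.ker_eq_bot, LinearMap.ker_eq_bot']
    intro u hu
    obtain ⟨v, rfl⟩ := (LinearMap.exact_lcomp_of_exact_of_surjective _ hDρ hρ u).mp hu
    have := extZero_zero_iff.mp hV0
    rw [Subsingleton.elim v 0, map_zero]
  have hrs : Function.Surjective rs :=
    lcomp_surjective_of_extZero (Submodule.subtype_injective _) hD' hexD'
      (extZero_ker_of_surjective hρ (hV 0))
  let q := (LinearMap.range c).mkQ
  have hq : Function.Surjective q := Submodule.mkQ_surjective _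
  have hcq : Function.Exact c q := LinearMap.exact_map_mkQ_range c
  have hrsc : ∀ u, rs (c u) = 0 := fun u => LinearMap.ext fun z => by
    change u (D z) = 0
    rw [LinearMap.mem_ker.mp z.2, map_zero]
  let π₀ : (((Fin b → R) →ₗ[R] ω) ⧸ LinearMap.range c) →ₗ[R] (LinearMap.ker D →ₗ[R] ω) :=
    (LinearMap.range c).liftQ rs (by rintro _ ⟨u, rfl⟩; exact hrsc u)
  have hπ₀q : ∀ u, π₀ (q u) = rs u := fun u => rfl
  have hπ₀ : Function.Surjective π₀ := fun z => (hrs z).imp' q fun _ h => h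
  let δ := connecting (Submodule.subtype_injective K) hρ (LinearMap.exact_subtype_ker_map ρ) ω
  let j : (K →ₗ[R] ω) →ₗ[R] (((Fin b → R) →ₗ[R] ω) ⧸ LinearMap.range c) := q ∘ₗ D'.lcomp R ω
  have hδj : LinearMap.ker δ = LinearMap.ker j := by
    rw [ker_connecting]
    ext u
    rw [LinearMap.mem_ker, LinearMap.comp_apply, Submodule.mkQ_apply,
      Submodule.Quotient.mk_eq_zero]
    constructor
    · rintro ⟨v, rfl⟩
      exact ⟨v, rfl⟩
    · rintro ⟨v, hv⟩
      refine ⟨v, LinearMap.ext fun k => ?_⟩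
      obtain ⟨z, rfl⟩ := hD' k
      exact LinearMap.congr_fun hv z
  obtain ⟨ι₀', hι₀', hι₀δ⟩ := exists_injective_of_ker_eq
    (connecting_surjective _ _ _ (extZero_succ_of_projective 0)) hδj
  let ι₀ := ι₀' ∘ₗ eM.toLinearMap
  have hι₀ : Function.Injective ι₀ := hι₀'.comp eM.injective
  have hι₀j : ∀ y, y ∈ Set.range ι₀ ↔ y ∈ Set.range j := by
    intro y
    constructor
    · rintro ⟨m, rfl⟩
      obtain ⟨u, hu⟩ := connecting_surjective (Submodule.subtype_injective K) hρ
        (LinearMap.exact_subtype_ker_map ρ) (extZero_succ_of_projective 0) (eM m)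
      exact ⟨u, (LinearMap.congr_fun hι₀δ u).symm.trans (congrArg ι₀' hu)⟩
    · rintro ⟨u, rfl⟩
      exact ⟨eM.symm (δ u), (congrArg ι₀' (eM.apply_symm_apply _)).trans
        (LinearMap.congr_fun hι₀δ u)⟩
  have h₀ : Function.Exact ι₀ π₀ := by
    intro y
    rw [hι₀j]
    constructor
    · intro hy
      obtain ⟨u, rfl⟩ := hq y
      obtain ⟨v, rfl⟩ := (LinearMap.exact_lcomp_of_exact_of_surjective _ hexD' hD' u).mp hy
      exact ⟨v, rfl⟩
    · rintro ⟨v, rfl⟩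
      exact (LinearMap.exact_lcomp_of_exact_of_surjective _ hexD' hD' _).mpr ⟨v, rfl⟩
  have hX₀d : DepthGE R d (LinearMap.ker D →ₗ[R] ω) := depthGE_hom hWd _ fun i =>
    extZero_left_fst (Submodule.subtype_injective _) hD' hexD' (extZero_succ_of_projective i)
      (extZero_ker_of_surjective hρ (hV (i + 1)))
  have hX₀Y : ExtZero R 1 (LinearMap.ker D →ₗ[R] ω) Y :=
    extZero_of_depthGE hY d _ hX₀d 1 (by omega)
  have hY₀ : ExtBound R d (((Fin b → R) →ₗ[R] ω) ⧸ LinearMap.range c) := fun N _ _ _ i hi =>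
    extZero_right_snd hc hq hcq (extZero_hom_free (hW N i hi))
      (extZero_hom_free (hW N (i + 1) (by omega)))
  have hXY₀ : ExtZero R 1 X (((Fin b → R) →ₗ[R] ω) ⧸ LinearMap.range c) :=
    extZero_of_depthGE hY₀ d X hX 1 (by omega)
  refine nonempty_equiv_of_minimal hι₀ hπ₀ h₀ hι hπ hex hX₀Y hXY₀ (fun φ hφ => ?_) hmin
  have hψ : (φ - LinearMap.id) ∘ₗ ι₀ = 0 := by
    rw [LinearMap.sub_comp, hφ, LinearMap.id_comp, sub_self]
  obtain ⟨h, hh⟩ := (LinearMap.exact_lcomp_of_exact_of_surjective _ h₀ hπ₀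
    (φ - LinearMap.id)).mp hψ
  obtain ⟨H, hH⟩ := exists_lift_of_extZero hc hq hcq
    (extZero_hom_free (extZero_of_depthGE hW d _ hX₀d 1 (by omega))) h
  refine bijective_of_sub_mem fun y => ?_
  obtain ⟨u, rfl⟩ := hq y
  have h1 : φ (q u) - q u = q ((H ∘ₗ rs) u) :=
    (LinearMap.congr_fun hh (q u)).symm.trans (LinearMap.congr_fun hH (rs u)).symm
  rw [h1]
  have h2 := apply_mem_smul_top hxω hx hend hD (H ∘ₗ rs) (fun v => by
    rw [LinearMap.comp_apply, show rs (v ∘ₗ D) = 0 from hrsc v, map_zero]) u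
  have h3 := Submodule.mem_map_of_mem (f := q) h2
  rw [Submodule.map_smul''] at h3
  exact Submodule.smul_mono le_rfl le_top h3

end Core

section Application

variable {R : Type} [CommRing R]

lemma exists_cover_of_isUnit {S : Type} [AddCommGroup S] [Module R S] {c : ℕ}
    {q : (Fin (c + 1) → R) →ₗ[R] S} (hq : Function.Surjective q) {z : Fin (c + 1) → R}
    (hz : q z = 0) {i : Fin (c + 1)} (hi : IsUnit (z i)) :
    ∃ q' : (Fin c → R) →ₗ[R] S, Function.Surjective q' := by
  let v : Fin (c + 1) → S := fun j => q (Pi.single j 1)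
  have hv : ∀ y, q y = ∑ j, y j • v j := fun y => by
    conv_lhs => rw [pi_eq_sum_univ' y, map_sum]
    exact Finset.sum_congr rfl fun j _ => map_smul _ _ _
  let q' := Fintype.linearCombination R fun l => v (i.succAbove l)
  have hmem : ∀ y : Fin (c + 1) → R,
      ∑ l, y (i.succAbove l) • v (i.succAbove l) ∈ LinearMap.range q' := fun y =>
    ⟨fun l => y (i.succAbove l), Fintype.linearCombination_apply R _ _⟩
  have hvi : v i ∈ LinearMap.range q' := by
    have h1 : z i • v i ∈ LinearMap.range q' := by
      rw [hv, Fin.sum_univ_succAbove _ i] at hz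
      rw [eq_neg_of_add_eq_zero_left hz]
      exact neg_mem (hmem z)
    obtain ⟨r, hr⟩ := hi.exists_left_inv
    have h2 := Submodule.smul_mem _ r h1
    rwa [← mul_smul, hr, one_smul] at h2
  refine ⟨q', fun s => ?_⟩
  obtain ⟨y, rfl⟩ := hq s
  rw [hv, Fin.sum_univ_succAbove _ i]
  exact add_mem (Submodule.smul_mem _ _ hvi) (hmem y)

/-- The presentation map extending `q` by one generator sent to `u`. -/
def presentation {a c : ℕ} (u : Fin a → R) (q : (Fin c → R) →ₗ[R] (Fin a → R)) :
    (Fin (c + 1) → R) →ₗ[R] (Fin a → R) :=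
  (LinearMap.toSpanSingleton R _ u) ∘ₗ LinearMap.proj 0 + q ∘ₗ LinearMap.funLeft R R Fin.succ

lemma presentation_apply {a c : ℕ} (u : Fin a → R) (q : (Fin c → R) →ₗ[R] (Fin a → R))
    (s : Fin (c + 1) → R) : presentation u q s = s 0 • u + q (fun i => s i.succ) := rfl

lemma presentation_eq_zero_iff {a c : ℕ} {W : Type} [AddCommGroup W] [Module R W]
    {p : (Fin a → R) →ₗ[R] W} {u : Fin a → R} {q : (Fin c → R) →ₗ[R] (Fin a → R)}
    (hpq : ∀ z, p (q z) = 0) (hu : ∀ t : R, t • p u = 0 → t = 0) (s : Fin (c + 1) → R) :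
    presentation u q s = 0 ↔ s 0 = 0 ∧ q (fun i => s i.succ) = 0 := by
  rw [presentation_apply]
  constructor
  · intro h
    have h0 : s 0 = 0 := hu _ (by
      have := congrArg p h
      rwa [map_add, hpq, add_zero, map_smul, map_zero] at this)
    rw [h0, zero_smul, zero_add] at h
    exact ⟨h0, h⟩
  · rintro ⟨h0, h⟩
    rw [h0, h, zero_smul, add_zero]

lemma HasFiniteInjDim.exists_extBound {Y : ModuleCat.{0} R} (h : HasFiniteInjDim R Y) :
    ∃ n, ExtBound R n Y := by
  obtain ⟨n, hn⟩ := h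
  exact ⟨n, fun N _ _ _ i hi => (subsingleton_modExt_iff i (ModuleCat.of R N) Y).mp (hn _ i hi)⟩

variable {ω : Ideal R} {y : R}

lemma extZero_zero_qmod (hy : y ∈ nonZeroDivisors R) :
    ExtZero R 0 (qmod R ω (Ideal.span {y})) ω := by
  rw [extZero_zero_iff]
  have key : ∀ u : qmod R ω (Ideal.span {y}) →ₗ[R] ω, u = 0 := by
    refine fun u => LinearMap.ext fun v => ?_
    obtain ⟨w, rfl⟩ := Submodule.mkQ_surjective _ v
    have h1 : y • (Submodule.comap ω.subtype (Ideal.span {y})).mkQ w = 0 := by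
      rw [← map_smul, Submodule.mkQ_apply, Submodule.Quotient.mk_eq_zero]
      exact Ideal.mul_mem_right _ _ (Ideal.mem_span_singleton_self y)
    have h2 : y • u ((Submodule.comap ω.subtype (Ideal.span {y})).mkQ w) = 0 := by
      rw [← map_smul, h1, map_zero]
    exact Subtype.ext ((mem_nonZeroDivisors_iff.mp hy).1 _ (congrArg Subtype.val h2))
  exact ⟨fun u v => (key u).trans (key v).symm⟩

lemma extZero_qmod (hyω : y ∈ ω) (hy : y ∈ nonZeroDivisors R)
    (hWW : ∀ i, ExtZero R (i + 1) ω ω) (i : ℕ) :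
    ExtZero R (i + 2) (qmod R ω (Ideal.span {y})) ω := by
  refine extZero_left_snd (f := LinearMap.toSpanSingleton R ω ⟨y, hyω⟩) ?_
    (Submodule.mkQ_surjective (Submodule.comap ω.subtype (Ideal.span {y}))) ?_ (hWW (i + 1))
    (extZero_succ_of_projective i)
  · rw [← LinearMap.ker_eq_bot, LinearMap.ker_eq_bot']
    exact fun t ht => (mem_nonZeroDivisors_iff.mp hy).2 _ (congrArg Subtype.val ht)
  · intro w
    rw [Submodule.mkQ_apply, Submodule.Quotient.mk_eq_zero, Submodule.mem_comap,
      Ideal.mem_span_singleton']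
    exact ⟨fun ⟨t, ht⟩ => ⟨t, Subtype.ext ht⟩, fun ⟨t, ht⟩ => ⟨t, congrArg Subtype.val ht⟩⟩

lemma exact_presentation_mkQ {a c : ℕ} {p : (Fin a → R) →ₗ[R] ω} {u : Fin a → R}
    (hu : (p u : R) = y) {q : (Fin c → R) →ₗ[R] (Fin a → R)} (hpq : Function.Exact q p) :
    Function.Exact (presentation u q)
      ((Submodule.comap ω.subtype (Ideal.span {y})).mkQ ∘ₗ p) := by
  intro v
  rw [LinearMap.comp_apply, Submodule.mkQ_apply, Submodule.Quotient.mk_eq_zero,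
    Submodule.mem_comap, Ideal.mem_span_singleton']
  constructor
  · rintro ⟨t, ht⟩
    have h1 : p (v - t • u) = 0 := by
      rw [map_sub, map_smul, sub_eq_zero]
      refine Subtype.ext ?_
      change (p v : R) = t * (p u : R)
      rw [hu, ht]
      rfl
    obtain ⟨z, hz⟩ := (hpq _).mp h1
    refine ⟨Fin.cons t z, ?_⟩
    rw [presentation_apply]
    simp only [Fin.cons_zero, Fin.cons_succ]
    rw [hz, add_sub_cancel]
  · rintro ⟨s, rfl⟩
    refine ⟨s 0, ?_⟩
    rw [presentation_apply, map_add, hpq.apply_apply_eq_zero, add_zero, map_smul, ← hu]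
    rfl

variable [IsLocalRing R]

local notation "𝔪" => IsLocalRing.maximalIdeal R
local notation "𝕜" => IsLocalRing.ResidueField R

/-- A finitely generated module over a local ring has a minimal free cover. -/
lemma exists_minimal_cover (S : Type) [AddCommGroup S] [Module R S] [Module.Finite R S] :
    ∃ (c : ℕ) (q : (Fin c → R) →ₗ[R] S), Function.Surjective q ∧
      ∀ z, q z = 0 → ∀ i, z i ∈ 𝔪 := by
  classical
  have h := Module.Finite.exists_fin' R S
  obtain ⟨n, q, hq, hmin⟩ : ∃ (n : ℕ) (q : (Fin n → R) →ₗ[R] S), Function.Surjective q ∧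
      ∀ m < n, ¬ ∃ q' : (Fin m → R) →ₗ[R] S, Function.Surjective q' :=
    ⟨_, (Nat.find_spec h).choose, (Nat.find_spec h).choose_spec, fun m hm => Nat.find_min h hm⟩
  refine ⟨n, q, hq, fun z hz i => ?_⟩
  by_contra hi
  have hunit : IsUnit (z i) := by
    by_contra hu
    exact hi ((IsLocalRing.mem_maximalIdeal _).mpr hu)
  cases n with
  | zero => exact i.elim0
  | succ c => exact hmin c (Nat.lt_succ_self c) (exists_cover_of_isUnit hq hz hunit)

lemma depthGE_of_moduleDepth_eq {M : ModuleCat.{0} R} {d : ℕ} (h : moduleDepth R M = d) :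
    DepthGE R d M ∧ ¬ ExtZero R d 𝕜 M := by
  have hmem : ∀ i : ℕ, ¬ ExtZero R i 𝕜 M → (d : ℕ∞) ≤ i := fun i hi => by
    rw [← h]
    refine sInf_le ⟨i, rfl, ?_⟩
    rw [← not_subsingleton_iff_nontrivial, subsingleton_modExt_iff]
    exact hi
  refine ⟨fun i hi => ?_, ?_⟩
  · by_contra hne
    exact absurd (hmem i hne) (by simpa using hi)
  · have hne : {n : ℕ∞ | ∃ m : ℕ, n = (m : ℕ∞) ∧
        Nontrivial (ModExt R m (ModuleCat.of R 𝕜) M)}.Nonempty := by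
      by_contra hemp
      rw [Set.not_nonempty_iff_eq_empty] at hemp
      rw [moduleDepth, hemp, sInf_empty] at h
      exact ENat.natCast_ne_top d h.symm
    obtain ⟨m, hm, hnt⟩ := csInf_mem hne
    have hdm : (d : ℕ∞) = m := h.symm.trans hm
    rw [Nat.cast_inj] at hdm
    rw [← not_subsingleton_iff_nontrivial, subsingleton_modExt_iff, ← hdm] at hnt
    exact hnt

/-- The cokernels of the minimal hulls attached to two regular elements of a canonical ideal
are isomorphic. -/
lemma nonempty_equiv_of_isMinFIDHull (hCM : IsCMLocalRing R) (hω : IsCanonicalIdeal R ω)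
    {y y' : R} (hyω : y ∈ ω) (hy : y ∈ nonZeroDivisors R) (hyω' : y' ∈ ω)
    (hy' : y' ∈ nonZeroDivisors R) {Y X Y' X' : ModuleCat R}
    {ι : (ModExt R 1 (qmod R ω (Ideal.span {y})) (ModuleCat.of R ↥ω)) →ₗ[R] Y} {π : Y →ₗ[R] X}
    (h : IsMinFIDHull R (ModExt R 1 (qmod R ω (Ideal.span {y})) (ModuleCat.of R ↥ω)) Y X ι π)
    {ι' : (ModExt R 1 (qmod R ω (Ideal.span {y'})) (ModuleCat.of R ↥ω)) →ₗ[R] Y'}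
    {π' : Y' →ₗ[R] X'}
    (h' : IsMinFIDHull R (ModExt R 1 (qmod R ω (Ideal.span {y'})) (ModuleCat.of R ↥ω))
      Y' X' ι' π') : Nonempty (X ≃ₗ[R] X') := by
  obtain ⟨hN, hdepth⟩ := hCM
  obtain ⟨hfin, hinj, d, hd, ⟨e⟩, hext⟩ := hω
  have hcast : ∀ M : ModuleCat.{0} R, (moduleDepth R M : WithBot ℕ∞) = ringKrullDim R →
      moduleDepth R M = d := fun M hM => by
    rw [hd] at hM
    exact_mod_cast hM
  obtain ⟨hRd, hRd'⟩ := depthGE_of_moduleDepth_eq (hcast _ hdepth)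
  have hfin' : Module.Finite R ω := hfin
  have hbound : ∀ Y : ModuleCat.{0} R, Module.Finite R Y → HasFiniteInjDim R Y →
      ExtBound R d Y := fun Y _ hY => by
    obtain ⟨n, hn⟩ := hY.exists_extBound
    exact extBound_depth hRd hRd' hn
  have hW : ExtBound R d ω := hbound _ hfin hinj
  have hWd : DepthGE R d ω := fun i hi => (subsingleton_modExt_iff _ _ _).mp (hext i hi.ne)
  have hWd' : ¬ ExtZero R d 𝕜 ω := fun h0 =>
    not_subsingleton 𝕜 (e.toEquiv.subsingleton_congr.mp ((subsingleton_modExt_iff _ _ _).mpr h0))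
  have hend := exists_smul_eq_of_end hyω hy hW hWd hWd'
  obtain ⟨a, p, hp⟩ := Module.Finite.exists_fin' R ω
  obtain ⟨c, q, hq, hqm⟩ := exists_minimal_cover (R := R) (LinearMap.ker p)
  let q' : (Fin c → R) →ₗ[R] (Fin a → R) := (LinearMap.ker p).subtype ∘ₗ q
  have hpq : Function.Exact q' p := by
    intro v
    constructor
    · intro hv
      obtain ⟨z, hz⟩ := hq ⟨v, hv⟩
      exact ⟨z, congrArg Subtype.val hz⟩
    · rintro ⟨z, rfl⟩
      exact (q z).2
  have hker : ∀ {y : R} {u : Fin a → R}, y ∈ nonZeroDivisors R → (p u : R) = y →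
      ∀ s, presentation u q' s = 0 ↔ s 0 = 0 ∧ q' (fun i => s i.succ) = 0 := fun hy hu s =>
    presentation_eq_zero_iff hpq.apply_apply_eq_zero (fun t ht =>
      (mem_nonZeroDivisors_iff.mp hy).2 t (hu ▸ congrArg Subtype.val ht)) s
  have key : ∀ {y : R} {u : Fin a → R} {Y X : ModuleCat R}
      {ι : (ModExt R 1 (qmod R ω (Ideal.span {y})) (ModuleCat.of R ↥ω)) →ₗ[R] Y} {π : Y →ₗ[R] X},
      y ∈ ω → y ∈ nonZeroDivisors R → (p u : R) = y →
      IsMinFIDHull R (ModExt R 1 (qmod R ω (Ideal.span {y})) (ModuleCat.of R ↥ω)) Y X ι π →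
      Nonempty (X ≃ₗ[R] (LinearMap.ker (presentation u q') →ₗ[R] ω)) := by
    intro y u Y X ι π hyω hy hu ⟨⟨_, hYfin, hYinj, hX, hι, hπ, hex⟩, hmin⟩
    have hXfin : Module.Finite R X := Module.Finite.of_surjective π hπ
    have hXd : DepthGE R d X := by
      rcases hX with hX | hX
      · exact (depthGE_of_moduleDepth_eq (hcast _ hX.2)).1
      · exact fun i _ => extZero_of_subsingleton_right i
    refine nonempty_equiv_hom_ker hyω hy hend hW hWd (extZero_zero_qmod hy)
      (extZero_qmod hyω hy (extZero_self_of_depthGE hW hWd))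
      ((Submodule.mkQ_surjective _).comp hp) (exact_presentation_mkQ hu hpq) (fun s hs => ?_)
      (modExtEquiv 0 _ _) hι hπ hex hmin (hbound Y hYfin hYinj) hXd
    obtain ⟨h0, h1⟩ := (hker hy hu s).mp hs
    intro i
    cases i using Fin.cases with
    | zero => rw [h0]; exact zero_mem _
    | succ i => exact hqm _ (Subtype.ext h1) i
  obtain ⟨u, hu⟩ := hp ⟨y, hyω⟩
  obtain ⟨u', hu'⟩ := hp ⟨y', hyω'⟩
  have hu := congrArg Subtype.val hu
  have hu' := congrArg Subtype.val hu'
  obtain ⟨f⟩ := key hyω hy hu h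
  obtain ⟨f'⟩ := key hyω' hy' hu' h'
  have hkk : LinearMap.ker (presentation u q') = LinearMap.ker (presentation u' q') := by
    ext s
    rw [LinearMap.mem_ker, LinearMap.mem_ker, hker hy hu, hker hy' hu']
  rw [hkk] at f
  exact ⟨f.trans f'.symm⟩

end Application

theorem stmt5 (R : Type) [CommRing R] [IsLocalRing R]
    (hCM : IsCMLocalRing R) (hGG : IsGenericallyGorenstein R)
    (hnG : ¬ IsGorensteinLocalRing R)
    (ω : Ideal R) (hω : IsCanonicalIdeal R ω)
    (x : R) (hxω : x ∈ ω) (hxreg : x ∈ nonZeroDivisors R) :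
    (∀ m n : ℕ, 1 ≤ m → 1 ≤ n →
      ∀ (Ym Xm : ModuleCat R) (ιm : (ModExt R 1 (qmod R ω (Ideal.span {x ^ m})) (ModuleCat.of R ↥ω)) →ₗ[R] Ym) (πm : Ym →ₗ[R] Xm),
        IsMinFIDHull R (ModExt R 1 (qmod R ω (Ideal.span {x ^ m})) (ModuleCat.of R ↥ω)) Ym Xm ιm πm →
      ∀ (Yn Xn : ModuleCat R) (ιn : (ModExt R 1 (qmod R ω (Ideal.span {x ^ n})) (ModuleCat.of R ↥ω)) →ₗ[R] Yn) (πn : Yn →ₗ[R] Xn),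
        IsMinFIDHull R (ModExt R 1 (qmod R ω (Ideal.span {x ^ n})) (ModuleCat.of R ↥ω)) Yn Xn ιn πn →
        WStablyIso R (ModuleCat.of R ↥ω) Xm Xn) ∧
    (∃ N : ℕ, 1 ≤ N ∧ ∀ m n : ℕ, N ≤ m → N ≤ n →
      ∀ (Ym Xm : ModuleCat R) (ιm : (ModExt R 1 (qmod R ω (Ideal.span {x ^ m})) (ModuleCat.of R ↥ω)) →ₗ[R] Ym) (πm : Ym →ₗ[R] Xm),
        IsMinFIDHull R (ModExt R 1 (qmod R ω (Ideal.span {x ^ m})) (ModuleCat.of R ↥ω)) Ym Xm ιm πm →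
      ∀ (Yn Xn : ModuleCat R) (ιn : (ModExt R 1 (qmod R ω (Ideal.span {x ^ n})) (ModuleCat.of R ↥ω)) →ₗ[R] Yn) (πn : Yn →ₗ[R] Xn),
        IsMinFIDHull R (ModExt R 1 (qmod R ω (Ideal.span {x ^ n})) (ModuleCat.of R ↥ω)) Yn Xn ιn πn →
        Nonempty (Xm ≃ₗ[R] Xn)) := by
  have key : ∀ k : ℕ, 1 ≤ k → x ^ k ∈ ω ∧ x ^ k ∈ nonZeroDivisors R := fun k hk =>
    ⟨Ideal.pow_mem_of_mem ω hxω k hk, pow_mem hxreg k⟩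
  refine ⟨fun m n hm hn Ym Xm ιm πm h Yn Xn ιn πn h' => ?_, 1, le_rfl,
    fun m n hm hn Ym Xm ιm πm h Yn Xn ιn πn h' => ?_⟩
  · obtain ⟨e⟩ := nonempty_equiv_of_isMinFIDHull hCM hω (key m hm).1 (key m hm).2
      (key n hn).1 (key n hn).2 h h'
    exact ⟨0, 0, ⟨e.prodCongr (LinearEquiv.refl R _)⟩⟩
  · exact nonempty_equiv_of_isMinFIDHull hCM hω (key m hm).1 (key m hm).2
      (key n hn).1 (key n hn).2 h h'

end
end
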